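/- There exist a universal constant C > 0 and a positive function f(p,α) such that: every p-convex body K ⊂ ℝⁿ with constant α, of volume 1 and in minimal mean-width position, satisfies M*(K) ≤ √n · min(f(p,α), C log(1+n)). -/

import Mathlib

open MeasureTheory Real Set
open scoped ENNReal RealInnerProductSpace Pointwise

noncomputable section

namespace GM

abbrev E (n : ℕ) := EuclideanSpace ℝ (Fin n)

variable {n : ℕ}

/-- A centrally-symmetric convex body. -/
def IsConvexBody (K : Set (E n)) : Prop :=
  IsCompact K ∧ Convex ℝ K ∧ (interior K).Nonempty ∧ K = -K

/-- The Euclidean unit sphere in `E n`. -/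
def usphere (n : ℕ) : Set (E n) := Metric.sphere 0 1

/-- Haar probability measure on the unit sphere, realized as the normalized
`(n-1)`-dimensional Hausdorff measure restricted to the sphere. -/
def sphMeasure (n : ℕ) : Measure (E n) :=
  (μH[(n : ℝ) - 1] (usphere n))⁻¹ • (μH[(n : ℝ) - 1]).restrict (usphere n)

/-- The marginal density `g_θ(s) = vol_{n-1}(K ∩ {sθ + θ^⊥})`. -/
def gdens (K : Set (E n)) (θ : E n) (s : ℝ) : ℝ :=
  (μH[(n : ℝ) - 1] (K ∩ {x : E n | ⟪x, θ⟫ = s})).toReal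

/-- The centered Gaussian density with variance `ρ²`. -/
def gauss (ρ s : ℝ) : ℝ :=
  (Real.sqrt (2 * π) * ρ)⁻¹ * Real.exp (-(s ^ 2) / (2 * ρ ^ 2))

/-- Kolmogorov-type distance between even densities. -/
def dKol (f₁ f₂ : ℝ → ℝ) : ℝ :=
  sSup {d | ∃ t > (0 : ℝ), d = |(∫ s in (-t)..t, f₁ s) - ∫ s in (-t)..t, f₂ s|}

/-- Linnik-type distance between densities. -/
def dLin (T : ℝ) (f₁ f₂ : ℝ → ℝ) : ℝ :=
  sSup {d | ∃ s : ℝ, 0 ≤ s ∧ s ≤ T ∧ d = |f₁ s / f₂ s - 1|}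

/-- `ρ_θ = (∫_K ⟨x,θ⟩² dx)^{1/2}`. -/
def rhoDir (K : Set (E n)) (θ : E n) : ℝ :=
  Real.sqrt (∫ x in K, ⟪x, θ⟫ ^ 2)

def rhoMax (K : Set (E n)) : ℝ := sSup (rhoDir K '' usphere n)

def rhoAvg (K : Set (E n)) : ℝ := ∫ θ, rhoDir K θ ∂(sphMeasure n)

/-- `C_iso(K) = ρ_max / ρ_avg`. -/
def Ciso (K : Set (E n)) : ℝ := rhoMax K / rhoAvg K

/-- Concentration hypothesis (⋆) with parameters `(ρ, A, B, ν, τ)`. -/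
def ConcHyp (K : Set (E n)) (ρ A B ν τ : ℝ) : Prop :=
  ∀ t : ℝ, 0 ≤ t → t ≤ 1 →
    volume {x : E n | x ∈ K ∧ t * ρ ≤ |‖x‖ / Real.sqrt n - ρ|} ≤
      ENNReal.ofReal (A * Real.exp (-B * (n : ℝ) ^ ν * t ^ τ))

/-- The modulus of convexity of `K` (w.r.t. the gauge norm of `K`). -/
def modConv (K : Set (E n)) (ε : ℝ) : ℝ :=
  sInf {d | ∃ x y : E n, gauge K x ≤ 1 ∧ gauge K y ≤ 1 ∧ ε ≤ gauge K (x - y) ∧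
    d = 1 - gauge K ((2⁻¹ : ℝ) • (x + y))}

/-- `K` is a `p`-convex body with constant `α`. -/
def IsPConvexBody (K : Set (E n)) (p α : ℝ) : Prop :=
  IsConvexBody K ∧ ∀ ε : ℝ, 0 < ε → ε ≤ 2 → α * ε ^ p ≤ modConv K ε

/-- Löwner's minimal diameter position. -/
def IsLowner (K : Set (E n)) : Prop :=
  ∀ T : E n →ₗ[ℝ] E n, |LinearMap.det T| = 1 →
    Metric.diam K ≤ Metric.diam (T '' K)

/-- The type-`s` constant of `X_K = (ℝⁿ, ‖·‖_K)`. -/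
def typeConst (K : Set (E n)) (s : ℝ) : ℝ :=
  sInf {T : ℝ | 0 < T ∧ ∀ m : ℕ, ∀ x : Fin m → E n,
    Real.sqrt (((2 : ℝ) ^ m)⁻¹ * ∑ ε : Fin m → Bool,
      gauge K (∑ i, (if ε i then (1 : ℝ) else -1) • x i) ^ 2) ≤
      T * (∑ i, gauge K (x i) ^ s) ^ (1 / s)}

/-- `X_K` is (isometric to) a subspace of a quotient of `L_p([0,1])`:
there is a closed submodule `N` of `L_p([0,1])` and a linear isometric embedding of
`(ℝⁿ, ‖·‖_K)` into the quotient `L_p([0,1]) ⧸ N` (with the quotient norm). -/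
def IsSubspaceOfQuotientOfLp (K : Set (E n)) (p : ℝ) (hp : 1 ≤ p) : Prop :=
  letI : Fact ((1 : ℝ≥0∞) ≤ ENNReal.ofReal p) := ⟨ENNReal.one_le_ofReal.mpr hp⟩
  ∃ N : Submodule ℝ (MeasureTheory.Lp ℝ (ENNReal.ofReal p) (volume.restrict (Icc (0 : ℝ) 1))),
    IsClosed (N : Set (MeasureTheory.Lp ℝ (ENNReal.ofReal p) (volume.restrict (Icc (0 : ℝ) 1)))) ∧
    ∃ J : E n →ₗ[ℝ]
      (MeasureTheory.Lp ℝ (ENNReal.ofReal p) (volume.restrict (Icc (0 : ℝ) 1)) ⧸ N),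
      ∀ x : E n, gauge K x = ‖J x‖

/-- `K` is isotropic with isotropic constant `L`. -/
def IsIsotropic (K : Set (E n)) (L : ℝ) : Prop :=
  volume K = 1 ∧ ∀ θ : E n, ‖θ‖ = 1 → (∫ x in K, ⟪x, θ⟫ ^ 2) = L ^ 2

/-- Entropy of `g` over `K`. -/
def entK (K : Set (E n)) (g : E n → ℝ) : ℝ :=
  (∫ x in K, g x * Real.log (g x)) - (∫ x in K, g x) * Real.log (∫ x in K, g x)

/-- `Var^q_K(f) = ∫_K |f - ∫_K f|^q`. -/
def varq (K : Set (E n)) (q : ℝ) (f : E n → ℝ) : ℝ :=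
  ∫ x in K, |f x - ∫ y in K, f y| ^ q

/-- The dual gauge `‖y‖_K^* = sup_{x ∈ K} ⟨x,y⟩`. -/
def dualGauge (K : Set (E n)) (y : E n) : ℝ :=
  sSup ((fun x : E n => ⟪x, y⟫) '' K)

/-- Half the mean width `M*(K)`. -/
def Mstar (K : Set (E n)) : ℝ := ∫ θ, dualGauge K θ ∂(sphMeasure n)

/-- Minimal mean-width position. -/
def IsMinMeanWidth (K : Set (E n)) : Prop :=
  ∀ T : E n →ₗ[ℝ] E n, |LinearMap.det T| = 1 → Mstar K ≤ Mstar (T '' K)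

/-- Positive definite symmetric linear map. -/
def IsPosDef (T : E n →ₗ[ℝ] E n) : Prop :=
  LinearMap.IsSymmetric T ∧ ∀ x : E n, x ≠ 0 → 0 < ⟪T x, x⟫

/-- Operator norm (w.r.t. the Euclidean norm). -/
def opNorm (T : E n →ₗ[ℝ] E n) : ℝ := ‖LinearMap.toContinuousLinearMap T‖

set_option linter.all false


/-! ### Abstract semigroup smoothing -/

theorem semigroup_start {V : Type*} [AddCommGroup V] [Module ℝ V] (N : Seminorm ℝ V)
    (S : ℝ → V →ₗ[ℝ] V)
    (hSadd : ∀ s t, 0 ≤ s → 0 ≤ t → ∀ f, S (s + t) f = S s (S t f))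
    (hS0 : ∀ f, S 0 f = f)
    (hc : ∀ t, 0 ≤ t → ∀ f, N (S t f) ≤ N f) (θ : ℝ) (hθ0 : 0 ≤ θ) (m : ℕ)
    (hm : 2 * θ ^ m ≤ 1 / 3)
    (hor : ∀ h, 0 ≤ h → ∀ g, N (g - S (2 * h) g) ≤ 1 / 3 * N g ∨ N (S h g) ≤ θ * N g)
    (h : ℝ) (hh : 0 ≤ h) (f : V) :
    N (S (m * h) f - S (m * h + 2 * h) f) ≤ 1 / 3 * N f := by
  have key : ∀ k : ℕ, N (S (k * h) f - S (k * h + 2 * h) f) ≤ 1 / 3 * N f ∨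
      N (S (k * h) f) ≤ θ ^ k * N f := by
    intro k
    induction k with
    | zero => right; simp [hS0]
    | succ k ih =>
      have hk : (0 : ℝ) ≤ k * h := by positivity
      have e1 : S ((k + 1 : ℕ) * h) f = S h (S (k * h) f) := by
        rw [← hSadd h (k * h) hh hk]; congr 2; push_cast; ring
      have e2 : S ((k + 1 : ℕ) * h + 2 * h) f = S h (S (k * h + 2 * h) f) := by
        rw [← hSadd h (k * h + 2 * h) hh (by positivity)]; congr 2; push_cast; ring
      rcases ih with ih | ih
      · left
        rw [e1, e2, ← map_sub]
        exact (hc h hh _).trans ih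
      · rcases hor h hh (S (k * h) f) with h1 | h1
        · left
          rw [e1, e2, ← map_sub]
          refine (hc h hh _).trans ?_
          have : S (k * h + 2 * h) f = S (2 * h) (S (k * h) f) := by
            rw [← hSadd _ _ (by positivity) hk, add_comm]
          rw [this]
          refine h1.trans ?_
          gcongr
          exact hc _ hk _
        · right
          rw [e1]
          refine h1.trans ?_
          calc θ * N (S (k * h) f) ≤ θ * (θ ^ k * N f) := by gcongr
            _ = _ := by ring
  rcases key m with h1 | h1
  · exact h1
  · have hmh : (0 : ℝ) ≤ m * h := by positivity
    calc N (S (m * h) f - S (m * h + 2 * h) f) ≤ N (S (m * h) f) + N (S (m * h + 2 * h) f) :=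
          map_sub_le_add N _ _
      _ ≤ N (S (m * h) f) + N (S (m * h) f) := by
          gcongr
          rw [add_comm, hSadd _ _ (by positivity) hmh]
          exact hc _ (by positivity) _
      _ ≤ 2 * θ ^ m * N f := by linarith
      _ ≤ 1 / 3 * N f := by gcongr

theorem semigroup_dyadic {V : Type*} [AddCommGroup V] [Module ℝ V] (N : Seminorm ℝ V)
    (S : ℝ → V →ₗ[ℝ] V)
    (hSadd : ∀ s t, 0 ≤ s → 0 ≤ t → ∀ f, S (s + t) f = S s (S t f))
    (x₀ : ℝ) (hx₀ : 0 ≤ x₀)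
    (h0 : ∀ t, 0 ≤ t → ∀ f, N (S t f - S (t + x₀ * t) f) ≤ 1 / 3 * N f) (i : ℕ) :
    ∀ t, 0 ≤ t → ∀ f, N (S t f - S (t + x₀ / 2 ^ i * t) f) ≤ 1 / (2 ^ i + 2) * N f := by
  induction i with
  | zero => intro t ht f; have := h0 t ht f; norm_num; norm_num at this; exact this
  | succ i ih =>
    intro t ht f
    set q : ℝ := 1 / (2 ^ i + 2) with hq
    have hq0 : 0 ≤ q := by positivity
    set h : ℝ := x₀ / 2 ^ (i + 1) * t with hh
    have hh0 : 0 ≤ h := by positivity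
    have hh1 : x₀ / 2 ^ i * t = 2 * h := by rw [hh, pow_succ]; field_simp
    have hh2 : x₀ / 2 ^ i * (t / 2) = h := by rw [hh, pow_succ]; field_simp
    have a1 : N (S t f - S (t + 2 * h) f) ≤ q * N f := by rw [← hh1]; exact ih t ht f
    set g := S (t / 2) f - S (t / 2 + h) f with hg
    have a2 : N g ≤ q * N f := by
      have := ih (t/2) (by positivity) f
      rwa [hh2] at this
    have a3 : N (S (t/2) g - S (t / 2 + h) g) ≤ q * N g := by
      have := ih (t/2) (by positivity) g
      rwa [hh2] at this
    have e : S (t/2) g - S (t / 2 + h) g = S t f - (2 : ℝ) • S (t + h) f + S (t + 2 * h) f := by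
      have ht2 : 0 ≤ t / 2 := by positivity
      rw [hg, map_sub, map_sub, ← hSadd _ _ ht2 ht2, ← hSadd _ _ ht2 (by positivity),
        ← hSadd _ _ (by positivity) ht2, ← hSadd _ _ (by positivity) (by positivity)]
      rw [show t / 2 + t / 2 = t by ring, show t / 2 + (t / 2 + h) = t + h by ring,
        show t / 2 + h + t / 2 = t + h by ring, show t / 2 + h + (t / 2 + h) = t + 2 * h by ring,
        two_smul]
      abel
    have e2 : S t f - S (t + h) f = (1/2 : ℝ) • (S t f - S (t + 2 * h) f) +
        (1/2 : ℝ) • (S (t/2) g - S (t / 2 + h) g) := by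
      rw [e]; module
    rw [e2]
    calc _ ≤ N ((1/2 : ℝ) • (S t f - S (t + 2 * h) f)) +
          N ((1/2 : ℝ) • (S (t/2) g - S (t / 2 + h) g)) := map_add_le_add N _ _
      _ = 1/2 * N (S t f - S (t + 2 * h) f) + 1/2 * N (S (t/2) g - S (t / 2 + h) g) := by
          rw [map_smul_eq_mul, map_smul_eq_mul]; norm_num
      _ ≤ 1/2 * (q * N f) + 1/2 * (q * (q * N f)) := by gcongr; exact a3.trans (by gcongr)
      _ = (q * (1 + q) / 2) * N f := by ring
      _ ≤ _ := by
          apply mul_le_mul_of_nonneg_right _ (apply_nonneg N f)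
          rw [hq, pow_succ]
          have : (0:ℝ) < 2 ^ i := by positivity
          generalize (2:ℝ) ^ i = y at this ⊢
          rw [show 1 / (y + 2) * (1 + 1 / (y + 2)) / 2 = (y + 3) / (2 * (y + 2) ^ 2) by
            field_simp; ring, div_le_div_iff₀ (by positivity) (by positivity)]
          nlinarith

theorem pairing_pow {V : Type*} [AddCommGroup V] [Module ℝ V]
    (S : ℝ → V →ₗ[ℝ] V)
    (hSadd : ∀ s t, 0 ≤ s → 0 ≤ t → ∀ f, S (s + t) f = S s (S t f))
    (Φ : V →ₗ[ℝ] ℝ) (f : V) (A : ℕ → ℂ) (hA : Summable fun k => ‖A k‖)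
    (hΦ : ∀ t, 0 < t → ((Φ (S t f) : ℝ) : ℂ) = ∑' k, A k * Real.exp (-t * k))
    (h t : ℝ) (hh : 0 ≤ h) (ht : 0 ≤ t) (j : ℕ) :
    ∀ r, 0 < r → ((Φ (((fun g => S t g - S (t + h) g)^[j]) (S r f)) : ℝ) : ℂ) =
      ∑' k, A k * (Real.exp (-r * k) * (Real.exp (-t * k) * (1 - Real.exp (-h * k))) ^ j : ℝ) := by
  have hsum : ∀ (i : ℕ) (r : ℝ), 0 < r → Summable fun k : ℕ => A k *
      (Real.exp (-r * k) * (Real.exp (-t * k) * (1 - Real.exp (-h * k))) ^ i : ℝ) := by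
    intro i r hr
    apply Summable.of_norm_bounded hA
    intro k
    rw [norm_mul]
    have : ‖((Real.exp (-r * k) * (Real.exp (-t * k) * (1 - Real.exp (-h * k))) ^ i : ℝ) : ℂ)‖ ≤ 1 := by
      rw [Complex.norm_real, Real.norm_eq_abs, abs_of_nonneg]
      · have e1 : Real.exp (-r * k) ≤ 1 := Real.exp_le_one_iff.2 (by nlinarith [Nat.cast_nonneg (α := ℝ) k])
        have e2 : Real.exp (-t * k) ≤ 1 := Real.exp_le_one_iff.2 (by nlinarith [Nat.cast_nonneg (α := ℝ) k])
        have e3 : Real.exp (-h * k) ≤ 1 := Real.exp_le_one_iff.2 (by nlinarith [Nat.cast_nonneg (α := ℝ) k])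
        have e4 := Real.exp_pos (-h * k)
        have e5 := Real.exp_pos (-t * k)
        have : (Real.exp (-t * k) * (1 - Real.exp (-h * k))) ≤ 1 := by nlinarith
        have h0 : 0 ≤ (Real.exp (-t * k) * (1 - Real.exp (-h * k))) := by
          apply mul_nonneg e5.le; linarith
        exact mul_le_one₀ e1 (pow_nonneg h0 _) (pow_le_one₀ h0 this)
      · have e3 : Real.exp (-h * k) ≤ 1 := Real.exp_le_one_iff.2 (by nlinarith [Nat.cast_nonneg (α := ℝ) k])
        have : 0 ≤ 1 - Real.exp (-h * k) := by linarith
        positivity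
    calc _ ≤ ‖A k‖ * 1 := by gcongr
      _ = _ := mul_one _
  have hlin : ∀ i (a b : V), ((fun g => S t g - S (t + h) g)^[i]) (a - b) =
      ((fun g => S t g - S (t + h) g)^[i]) a - ((fun g => S t g - S (t + h) g)^[i]) b := by
    intro i
    induction i with
    | zero => intro a b; rfl
    | succ i ih =>
      intro a b
      simp only [Function.iterate_succ, Function.comp]
      rw [← ih]
      congr 1
      simp only [map_sub]; abel
  induction j with
  | zero => intro r hr; simpa using hΦ r hr
  | succ j ih =>
    intro r hr
    simp only [Function.iterate_succ, Function.comp]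
    rw [hlin, map_sub, Complex.ofReal_sub, ← hSadd _ _ ht hr.le, ← hSadd _ _ (by positivity) hr.le,
      ih _ (by positivity), ih _ (by positivity), ← (hsum _ _ (by positivity)).tsum_sub (hsum _ _ (by positivity))]
    congr 1; ext k
    rw [← mul_sub, ← Complex.ofReal_sub]
    congr 2
    have e1 : Real.exp (-(t + r) * k) = Real.exp (-t * k) * Real.exp (-r * k) := by
      rw [← Real.exp_add]; ring_nf
    have e2 : Real.exp (-(t + h + r) * k) = Real.exp (-t * k) * Real.exp (-h * k) * Real.exp (-r * k) := by
      rw [← Real.exp_add, ← Real.exp_add]; ring_nf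
    rw [e1, e2]; ring

theorem deriv_bound {V : Type*} [AddCommGroup V] [Module ℝ V] (N : Seminorm ℝ V)
    (S : ℝ → V →ₗ[ℝ] V)
    (hSadd : ∀ s t, 0 ≤ s → 0 ≤ t → ∀ f, S (s + t) f = S s (S t f))
    (hc : ∀ t, 0 ≤ t → ∀ f, N (S t f) ≤ N f)
    (x₀ : ℝ) (hx₀ : 0 < x₀)
    (h0 : ∀ t, 0 ≤ t → ∀ f, N (S t f - S (t + x₀ * t) f) ≤ 1 / 3 * N f)
    (Φ : V →ₗ[ℝ] ℝ) (c : ℝ) (hc0 : 0 ≤ c) (hΦc : ∀ g, |Φ g| ≤ c * N g)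
    (f : V) (A : ℕ → ℂ) (hA : Summable fun k => ‖A k‖)
    (hΦ : ∀ t, 0 < t → ((Φ (S t f) : ℝ) : ℂ) = ∑' k, A k * Real.exp (-t * k))
    (a : ℝ) (ha : 0 < a) (j : ℕ) :
    ‖∑' k, A k * ((k : ℝ) ^ j * Real.exp (-a * k) : ℝ)‖ ≤ c * N f * ((j + 1) / (x₀ * a)) ^ j := by
  set t : ℝ := a / (j + 1) with ht
  have ht0 : 0 < t := by positivity
  have hta : t + j * t = a := by rw [ht]; field_simp; ring
  set h : ℕ → ℝ := fun i => x₀ / 2 ^ i * t with hh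
  have hhpos : ∀ i, 0 < h i := fun i => by simp only [hh]; positivity
  have hhlim : Filter.Tendsto h Filter.atTop (nhds 0) := by
    have : Filter.Tendsto (fun i : ℕ => x₀ * t * (1/2 : ℝ) ^ i) Filter.atTop (nhds (x₀ * t * 0)) :=
      (tendsto_pow_atTop_nhds_zero_of_lt_one (by norm_num) (by norm_num)).const_mul _
    rw [mul_zero] at this
    refine this.congr fun i => ?_
    simp only [hh]; rw [one_div, inv_pow]; field_simp
  set F : ℕ → ℕ → ℂ := fun i k => A k * ((Real.exp (-t * k) *
    (Real.exp (-t * k) * ((1 - Real.exp (-h i * k)) / h i)) ^ j : ℝ) : ℂ) with hF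
  -- bounds for F
  have hbd : ∀ i, ‖∑' k, F i k‖ ≤ c * N f * ((j + 1) / (x₀ * a)) ^ j := by
    intro i
    have e := pairing_pow S hSadd Φ f A hA hΦ (h i) t (hhpos i).le ht0.le j t ht0
    have e2 : ∑' k, F i k = ((h i) ^ j : ℝ)⁻¹ * ((Φ (((fun g => S t g - S (t + h i) g)^[j]) (S t f)) : ℝ) : ℂ) := by
      rw [e, ← tsum_mul_left]
      congr 1; ext k
      simp only [hF]
      push_cast
      have : ((h i : ℝ) : ℂ) ≠ 0 := by exact_mod_cast (hhpos i).ne'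
      rw [mul_pow, mul_pow, div_pow]
      field_simp
    have e3 : N (((fun g => S t g - S (t + h i) g)^[j]) (S t f)) ≤ (1 / 2 ^ i : ℝ) ^ j * N f := by
      have : ∀ l : ℕ, N (((fun g => S t g - S (t + h i) g)^[l]) (S t f)) ≤ (1 / 2 ^ i : ℝ) ^ l * N f := by
        intro l
        induction l with
        | zero => simpa using hc t ht0.le f
        | succ l ih =>
          rw [Function.iterate_succ_apply']
          refine (semigroup_dyadic N S hSadd x₀ hx₀.le h0 i t ht0.le _).trans ?_
          calc _ ≤ (1 / 2 ^ i : ℝ) * ((1 / 2 ^ i : ℝ) ^ l * N f) := by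
                apply mul_le_mul _ ih (apply_nonneg N _) (by positivity)
                apply one_div_le_one_div_of_le (by positivity); linarith
            _ = _ := by ring
      exact this j
    rw [e2, norm_mul, Complex.norm_real, norm_inv, Complex.norm_real, Real.norm_eq_abs, Real.norm_eq_abs,
      abs_of_pos (pow_pos (hhpos i) j)]
    calc (h i ^ j)⁻¹ * |Φ (((fun g => S t g - S (t + h i) g)^[j]) (S t f))|
        ≤ (h i ^ j)⁻¹ * (c * ((1 / 2 ^ i : ℝ) ^ j * N f)) := by
          apply mul_le_mul_of_nonneg_left _ (inv_nonneg.2 (pow_nonneg (hhpos i).le _))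
          exact (hΦc _).trans (by gcongr)
      _ = c * N f * ((j + 1) / (x₀ * a)) ^ j := by
          rw [show ((j : ℝ) + 1) / (x₀ * a) = (h i)⁻¹ * (1 / 2 ^ i) by
            simp only [hh, ht]; field_simp]
          rw [mul_pow ((h i)⁻¹), inv_pow]; ring
  have hlim : Filter.Tendsto (fun i => ∑' k, F i k) Filter.atTop
      (nhds (∑' k, A k * ((k : ℝ) ^ j * Real.exp (-a * k) : ℝ))) := by
    have hmax : ∀ k : ℕ, (k : ℝ) ^ j * Real.exp (-a * k) ≤ (j.factorial : ℝ) / a ^ j := by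
      intro k
      have := Real.pow_div_factorial_le_exp (a * k) (by positivity) j
      rw [neg_mul, Real.exp_neg, ← div_eq_mul_inv, div_le_div_iff₀ (Real.exp_pos _) (by positivity)]
      rw [div_le_iff₀ (by positivity), mul_pow] at this
      linarith
    apply tendsto_tsum_of_dominated_convergence (bound := fun k => ‖A k‖ * ((j.factorial : ℝ) / a ^ j))
    · exact hA.mul_right _
    · intro k
      simp only [hF]
      apply Filter.Tendsto.const_mul
      refine (Complex.continuous_ofReal.tendsto _).comp ?_
      have hl : Filter.Tendsto (fun i => (1 - Real.exp (-h i * k)) / h i) Filter.atTop (nhds (k : ℝ)) := by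
        have hd : HasDerivAt (fun x : ℝ => 1 - Real.exp (-x * k)) (k : ℝ) 0 := by
          have := ((((hasDerivAt_id (0:ℝ)).neg).mul_const (k:ℝ)).exp).const_sub 1
          simpa using this
        have h2 := hd.tendsto_slope_zero
        have h3 : Filter.Tendsto h Filter.atTop (nhdsWithin 0 {0}ᶜ) :=
          tendsto_nhdsWithin_iff.2 ⟨hhlim, Filter.Eventually.of_forall fun i => (hhpos i).ne'⟩
        refine (h2.comp h3).congr fun i => ?_
        simp [div_eq_inv_mul]
      have h4 := ((hl.const_mul (Real.exp (-t * k))).pow j).const_mul (Real.exp (-t * k))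
      convert h4 using 2
      rw [mul_pow, ← Real.exp_nat_mul, ← mul_assoc, ← Real.exp_add, mul_comm]
      congr 2
      rw [← hta]; ring
    · refine Filter.Eventually.of_forall fun i k => ?_
      simp only [hF]
      rw [norm_mul]
      gcongr
      rw [Complex.norm_real, Real.norm_eq_abs]
      have hp := hhpos i
      have e3 : Real.exp (-h i * k) ≤ 1 := Real.exp_le_one_iff.2 (by nlinarith [Nat.cast_nonneg (α := ℝ) k])
      have e4 : (1 - Real.exp (-h i * k)) / h i ≤ k := by
        rw [div_le_iff₀ hp]
        have := Real.add_one_le_exp (-h i * k)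
        nlinarith
      have e5 : 0 ≤ (1 - Real.exp (-h i * k)) / h i := div_nonneg (by linarith) hp.le
      rw [abs_of_nonneg (by positivity)]
      refine le_trans ?_ (hmax k)
      calc Real.exp (-t * k) * (Real.exp (-t * k) * ((1 - Real.exp (-h i * k)) / h i)) ^ j
          ≤ Real.exp (-t * k) * (Real.exp (-t * k) * k) ^ j := by gcongr
        _ = _ := by
          rw [mul_pow, ← Real.exp_nat_mul, ← mul_assoc, ← Real.exp_add, mul_comm]
          congr 2
          rw [← hta]; ring
  exact le_of_tendsto hlim.norm (Filter.Eventually.of_forall hbd)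



/-! ### Complex analysis -/

theorem powser_diff (A : ℕ → ℂ) (hA : Summable fun k => ‖A k‖) :
    DifferentiableOn ℂ (fun w : ℂ => ∑' k, A k * w ^ k) (Metric.ball 0 1) := by
  apply Complex.differentiableOn_tsum_of_summable_norm hA
  · intro i; fun_prop
  · exact Metric.isOpen_ball
  · intro i w hw
    rw [norm_mul, norm_pow]
    have : ‖w‖ < 1 := by simpa using hw
    calc _ ≤ ‖A i‖ * 1 := by gcongr; exact pow_le_one₀ (norm_nonneg _) this.le
      _ = _ := mul_one _

theorem powser_summable (A : ℕ → ℂ) (hA : Summable fun k => ‖A k‖) (w : ℂ) (hw : ‖w‖ ≤ 1) :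
    Summable fun k => A k * w ^ k := by
  apply Summable.of_norm_bounded hA
  intro i
  rw [norm_mul, norm_pow]
  calc _ ≤ ‖A i‖ * 1 := by gcongr; exact pow_le_one₀ (norm_nonneg _) hw
    _ = _ := mul_one _

theorem powser_norm_le (A : ℕ → ℂ) (hA : Summable fun k => ‖A k‖) (w : ℂ) (hw : ‖w‖ ≤ 1) :
    ‖∑' k, A k * w ^ k‖ ≤ ∑' k, ‖A k‖ := by
  apply tsum_of_norm_bounded hA.hasSum
  intro i
  rw [norm_mul, norm_pow]
  calc _ ≤ ‖A i‖ * 1 := by gcongr; exact pow_le_one₀ (norm_nonneg _) hw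
    _ = _ := mul_one _

theorem powser_deriv (A : ℕ → ℂ) (hA : Summable fun k => ‖A k‖) :
    HasDerivAt (fun w : ℂ => ∑' k, A k * w ^ k) (A 1) 0 := by
  have hA2 : Summable fun k => ‖A (k + 2)‖ := (summable_nat_add_iff 2).2 hA
  have hsplit : ∀ w : ℂ, ‖w‖ ≤ 1 → ∑' k, A k * w ^ k =
      A 0 + A 1 * w + w ^ 2 * ∑' k, A (k + 2) * w ^ k := by
    intro w hw
    rw [← (powser_summable A hA w hw).sum_add_tsum_nat_add 2, ← tsum_mul_left]
    simp only [Finset.sum_range_succ, Finset.sum_range_zero]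
    congr 1
    · simp
    · congr 1; ext k; ring
  have h0 : (fun w : ℂ => ∑' k, A k * w ^ k) =ᶠ[nhds 0]
      fun w => A 0 + A 1 * w + w ^ 2 * ∑' k, A (k + 2) * w ^ k := by
    filter_upwards [Metric.closedBall_mem_nhds (0:ℂ) one_pos] with w hw
    exact hsplit w (by simpa using hw)
  refine HasDerivAt.congr_of_eventuallyEq ?_ h0
  have hd : DifferentiableAt ℂ (fun w : ℂ => ∑' k, A (k + 2) * w ^ k) 0 :=
    (powser_diff _ hA2).differentiableAt (Metric.ball_mem_nhds _ one_pos)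
  have h1 := (((hasDerivAt_id (0:ℂ)).const_mul (A 1)).const_add (A 0)).add
    (((hasDerivAt_id (0:ℂ)).pow 2).mul hd.hasDerivAt)
  exact HasDerivAt.congr_deriv h1 (by simp)

theorem A1_le_of_deriv_bounds (A : ℕ → ℂ) (hA : Summable fun k => ‖A k‖) (C x₀ : ℝ) (hC : 0 ≤ C)
    (hx₀ : 0 < x₀) (hx₁ : x₀ ≤ 2) (a : ℝ) (ha : a = 2 * π * Real.exp 1 / x₀)
    (hb : ∀ j : ℕ, ‖∑' k, A k * ((k : ℝ) ^ j * Real.exp (-a * k) : ℝ)‖ ≤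
      C * ((j + 1) / (x₀ * a)) ^ j) :
    ‖A 1‖ ≤ 2 * Real.exp 1 * C * Real.exp a := by
  have haπ : π ≤ a := by
    rw [ha, le_div_iff₀ hx₀]
    have := Real.add_one_le_exp (1:ℝ)
    nlinarith [Real.pi_pos]
  have ha0 : 0 < a := lt_of_lt_of_le Real.pi_pos haπ
  have hr1 : Real.exp (-a) < 1 := by rw [Real.exp_lt_one_iff]; linarith
  have hsph : ∀ w ∈ Metric.sphere (0:ℂ) (Real.exp (-a)), ‖∑' k, A k * w ^ k‖ ≤ 2 * Real.exp 1 * C := by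
    intro w hw
    have hwn : ‖w‖ = Real.exp (-a) := by simpa using hw
    set θ := Complex.arg w with hθ
    have hθπ : |θ| ≤ π := Complex.abs_arg_le_pi w
    have hwe : w = Complex.exp (-a) * Complex.exp (θ * Complex.I) := by
      conv_lhs => rw [← Complex.norm_mul_exp_arg_mul_I w, hwn]
      push_cast; rfl
    set F : ℕ → ℕ → ℂ := fun k j => A k * ((Real.exp (-a * k) : ℝ) : ℂ) *
      (((θ * Complex.I * k) ^ j) / (j.factorial : ℂ)) with hF
    have hFn : ∀ k j, ‖F k j‖ = ‖A k‖ * Real.exp (-a * k) * ((|θ| * k) ^ j / j.factorial) := by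
      intro k j
      simp only [hF, norm_mul, norm_div, norm_pow, Complex.norm_real, Complex.norm_I, mul_one,
        Complex.norm_natCast, Real.norm_eq_abs, abs_of_pos (Real.exp_pos _)]
    have hexp : ∀ z : ℝ, HasSum (fun j : ℕ => z ^ j / j.factorial) (Real.exp z) := fun z => by
      rw [Real.exp_eq_exp_ℝ]; exact NormedSpace.expSeries_div_hasSum_exp z
    have hcexp : ∀ z : ℂ, HasSum (fun j : ℕ => z ^ j / j.factorial) (Complex.exp z) := fun z => by
      rw [Complex.exp_eq_exp_ℂ]; exact NormedSpace.expSeries_div_hasSum_exp z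
    have hFs : Summable (Function.uncurry F) := by
      apply Summable.of_norm
      rw [summable_prod_of_nonneg (fun _ => norm_nonneg _)]
      simp only [Function.uncurry, hFn]
      refine ⟨fun k => ((hexp _).mul_left _).summable, ?_⟩
      simp only [fun k : ℕ => ((hexp (|θ| * k)).mul_left (‖A k‖ * Real.exp (-a * k))).tsum_eq]
      refine Summable.of_nonneg_of_le (fun k => by positivity) (fun k => ?_) hA
      rw [mul_assoc, ← Real.exp_add]
      calc _ ≤ ‖A k‖ * 1 := by
            gcongr
            rw [Real.exp_le_one_iff]
            nlinarith [Nat.cast_nonneg (α := ℝ) k]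
        _ = _ := mul_one _
    have e1 : ∑' k, A k * w ^ k = ∑' k, ∑' j, F k j := by
      congr 1; ext k
      simp only [hF]
      rw [((hcexp (θ * Complex.I * k)).mul_left _).tsum_eq, hwe, mul_pow, ← Complex.exp_nat_mul,
        ← Complex.exp_nat_mul, mul_assoc]
      push_cast
      congr 3 <;> ring
    rw [e1, ← hFs.tsum_comm]
    have hx₀a : x₀ * a = 2 * π * Real.exp 1 := by rw [ha]; field_simp
    have hgeo : HasSum (fun j : ℕ => Real.exp 1 * C * (1/2 : ℝ) ^ j) (2 * Real.exp 1 * C) := by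
      have := (hasSum_geometric_two).mul_left (Real.exp 1 * C)
      rwa [show Real.exp 1 * C * 2 = 2 * Real.exp 1 * C by ring] at this
    apply tsum_of_norm_bounded hgeo
    intro j
    have e2 : ∑' k, F k j = ((θ * Complex.I) ^ j / (j.factorial : ℂ)) *
        ∑' k, A k * ((k : ℝ) ^ j * Real.exp (-a * k) : ℝ) := by
      rw [← tsum_mul_left]; congr 1; ext k
      simp only [hF, mul_pow]; push_cast; ring
    rw [e2, norm_mul, norm_div, norm_pow, norm_mul, Complex.norm_I, mul_one, Complex.norm_real,
      Complex.norm_natCast, Real.norm_eq_abs]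
    have h3 : ((j : ℝ) + 1) ^ j / j.factorial ≤ Real.exp 1 * Real.exp 1 ^ j := by
      have := Real.pow_div_factorial_le_exp ((j : ℝ) + 1) (by positivity) (j + 1)
      rw [Nat.factorial_succ, pow_succ] at this
      push_cast at this
      rw [mul_comm ((j:ℝ) + 1) (j.factorial : ℝ), mul_div_mul_right _ _ (by positivity)] at this
      refine this.trans (le_of_eq ?_)
      rw [← Real.exp_nat_mul, ← Real.exp_add]; ring_nf
    calc |θ| ^ j / j.factorial * ‖∑' k, A k * ((k : ℝ) ^ j * Real.exp (-a * k) : ℝ)‖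
        ≤ π ^ j / j.factorial * (C * ((j + 1) / (x₀ * a)) ^ j) := by
          gcongr
          exact hb j
      _ = C * (π / (x₀ * a)) ^ j * (((j : ℝ) + 1) ^ j / j.factorial) := by
          rw [div_pow, div_pow]; ring
      _ ≤ C * (π / (x₀ * a)) ^ j * (Real.exp 1 * Real.exp 1 ^ j) := by gcongr
      _ = Real.exp 1 * C * (π / (x₀ * a) * Real.exp 1) ^ j := by rw [mul_pow]; ring
      _ = _ := by
          rw [hx₀a]; congr 2; field_simp
  have hd := Complex.norm_deriv_le_of_forall_mem_sphere_norm_le (Real.exp_pos (-a))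
    (f := fun w : ℂ => ∑' k, A k * w ^ k) (c := 0) (C := 2 * Real.exp 1 * C) ?_ hsph
  · rw [(powser_deriv A hA).deriv] at hd
    refine hd.trans (le_of_eq ?_)
    rw [Real.exp_neg]; field_simp
  · apply DifferentiableOn.diffContOnCl
    rw [closure_ball _ (Real.exp_pos _).ne']
    exact (powser_diff A hA).mono (Metric.closedBall_subset_ball hr1)

theorem norm_sin_le (w : ℂ) (hw : |w.im| ≤ 1) : ‖Complex.sin w / 2‖ < 1 := by
  rw [Complex.sin, norm_div, norm_div, norm_mul, Complex.norm_I]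
  simp only [Complex.norm_ofNat, mul_one]
  have h1 : ‖Complex.exp (-w * Complex.I) - Complex.exp (w * Complex.I)‖ ≤
      Real.exp (w.im) + Real.exp (-w.im) := by
    refine (norm_sub_le _ _).trans ?_
    rw [Complex.norm_exp, Complex.norm_exp]; simp
  have hab := abs_le.1 hw
  have h2 : Real.exp (w.im) + Real.exp (-w.im) < 4 := by
    have hc : Real.exp w.im + Real.exp (-w.im) = 2 * Real.cosh w.im := by rw [Real.cosh_eq]; ring
    have hc1 : Real.cosh w.im ≤ Real.cosh 1 := Real.cosh_le_cosh.2 (by simpa using hw)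
    have hc2 : 2 * Real.cosh 1 = Real.exp 1 + Real.exp (-1) := by rw [Real.cosh_eq]; ring
    have := Real.exp_one_lt_d9
    have h5 : Real.exp (-1) < 1 := by rw [Real.exp_lt_one_iff]; norm_num
    linarith
  linarith

theorem A1_le_log (A : ℕ → ℂ) (hA : Summable fun k => ‖A k‖) (D : ℝ) (hD : 1 < D)
    (hAD : ∑' k, ‖A k‖ ≤ D)
    (hb : ∀ s : ℝ, |s| ≤ 1 / 2 → ‖∑' k, A k * (s : ℂ) ^ k‖ ≤ 1) :
    ‖A 1‖ ≤ 2 * Real.exp 1 * (1 + Real.log D) := by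
  set φ : ℂ → ℂ := fun w : ℂ => ∑' k, A k * w ^ k with hφ
  have hL : 0 < Real.log D := Real.log_pos hD
  set ρ : ℝ := 1 / (1 + Real.log D) with hρ
  have hρ0 : 0 < ρ := by positivity
  have hρ1 : ρ < 1 := by rw [hρ, div_lt_one (by positivity)]; linarith
  -- the two strips
  have strip : ∀ ε : ℂ, (ε = Complex.I ∨ ε = -Complex.I) → ∀ z : ℂ, 0 ≤ z.re → z.re ≤ 1 →
      ‖φ (Complex.sin (ε * z) / 2)‖ ≤ D ^ z.re := by
    intro ε hε z hz0 hz1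
    have him : ∀ z : ℂ, |(ε * z).im| = |z.re| := by
      intro z; rcases hε with rfl | rfl <;> simp
    have hball : ∀ z : ℂ, 0 ≤ z.re → z.re ≤ 1 → ‖Complex.sin (ε * z) / 2‖ < 1 := by
      intro z h0 h1
      apply norm_sin_le; rw [him, abs_of_nonneg h0]; exact h1
    have hle : ∀ z : ℂ, 0 ≤ z.re → z.re ≤ 1 → ‖φ (Complex.sin (ε * z) / 2)‖ ≤ D := by
      intro z h0 h1
      exact (powser_norm_le A hA _ (hball z h0 h1).le).trans hAD
    have h := Complex.HadamardThreeLines.norm_le_interp_of_mem_verticalClosedStrip₀₁'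
      (fun z => φ (Complex.sin (ε * z) / 2)) (z := z) (a := 1) (b := D) ⟨hz0, hz1⟩ ?_ ?_ ?_ ?_
    · simpa using h
    · apply DifferentiableOn.diffContOnCl
      intro z hz
      have hz' : 0 ≤ z.re ∧ z.re ≤ 1 := by
        have : closure (Complex.HadamardThreeLines.verticalStrip 0 1) ⊆
            Complex.re ⁻¹' (Icc 0 1) := by
          apply closure_minimal
          · intro z hz; exact ⟨hz.1.le, hz.2.le⟩
          · exact isClosed_Icc.preimage Complex.continuous_re
        exact this hz
      have h1 : DifferentiableAt ℂ φ (Complex.sin (ε * z) / 2) :=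
        (powser_diff A hA).differentiableAt (Metric.isOpen_ball.mem_nhds (by
          simpa using hball z hz'.1 hz'.2))
      apply DifferentiableAt.differentiableWithinAt
      exact DifferentiableAt.comp (g := φ) (f := fun z => Complex.sin (ε * z) / 2) z h1 (by fun_prop)
    · refine ⟨D, ?_⟩
      rintro _ ⟨z, hz, rfl⟩
      exact hle z hz.1 hz.2
    · intro z hz
      have hz : z.re = 0 := hz
      have : ∃ x : ℝ, ε * z = x := by
        refine ⟨(ε * z).re, ?_⟩
        apply Complex.ext
        · simp
        · have := him z; rw [hz, abs_zero, abs_eq_zero] at this; simpa using this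
      obtain ⟨x, hx⟩ := this
      have h2 := hb (Real.sin x / 2) (by
        rw [abs_div, abs_of_pos (by norm_num : (0:ℝ) < 2)]
        have := Real.abs_sin_le_one x; linarith)
      simp only [hx, hφ]
      push_cast at h2
      exact h2
    · intro z hz
      have hz : z.re = 1 := hz
      exact hle z (by rw [hz]; norm_num) (by rw [hz])
  have hbound : ∀ w : ℂ, |w.im| ≤ ρ → ‖φ (Complex.sin w / 2)‖ ≤ Real.exp 1 := by
    intro w hw
    have h1 : ‖φ (Complex.sin w / 2)‖ ≤ D ^ |w.im| := by
      rcases le_total 0 w.im with h | h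
      · have := strip Complex.I (Or.inl rfl) (-Complex.I * w) (by simpa using h) (by
          have := abs_le.1 hw; simp; linarith)
        rw [← mul_assoc] at this
        simpa [abs_of_nonneg h] using this
      · have := strip (-Complex.I) (Or.inr rfl) (Complex.I * w) (by simpa using h) (by
          have := abs_le.1 hw; simp; linarith)
        rw [← mul_assoc] at this
        simpa [abs_of_nonpos h] using this
    refine h1.trans ((Real.rpow_le_rpow_of_exponent_le hD.le hw).trans ?_)
    rw [Real.rpow_def_of_pos (by linarith)]
    apply Real.exp_le_exp.2
    rw [hρ, mul_one_div, div_le_one (by positivity)]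
    linarith
  have hd := Complex.norm_deriv_le_of_forall_mem_sphere_norm_le hρ0
    (f := fun w : ℂ => φ (Complex.sin w / 2)) (c := 0) (C := Real.exp 1) ?_ ?_
  · have h1 : HasDerivAt φ (A 1) (Complex.sin 0 / 2) := by
      rw [Complex.sin_zero, zero_div]; exact powser_deriv A hA
    have h2 : HasDerivAt (fun w : ℂ => φ (Complex.sin w / 2)) (A 1 * (Complex.cos 0 / 2)) 0 :=
      HasDerivAt.comp (h₂ := φ) (h := fun x => Complex.sin x / 2) (0:ℂ) h1 ((Complex.hasDerivAt_sin 0).div_const 2)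
    rw [h2.deriv, Complex.cos_zero, norm_mul] at hd
    simp only [norm_div, norm_one, Complex.norm_ofNat] at hd
    have h3 : Real.exp 1 / ρ = Real.exp 1 * (1 + Real.log D) := by rw [hρ]; field_simp
    rw [h3] at hd
    linarith
  · apply DifferentiableOn.diffContOnCl
    rw [closure_ball _ hρ0.ne']
    intro z hz
    have hz : ‖z‖ ≤ ρ := by simpa using hz
    have h1 : DifferentiableAt ℂ φ (Complex.sin z / 2) :=
        (powser_diff A hA).differentiableAt (Metric.isOpen_ball.mem_nhds (by
          simpa using norm_sin_le z ((Complex.abs_im_le_norm z).trans (hz.trans hρ1.le))))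
    apply DifferentiableAt.differentiableWithinAt
    exact DifferentiableAt.comp (g := φ) (f := fun z => Complex.sin z / 2) z h1 (by fun_prop)
  · intro z hz
    apply hbound
    have hz : ‖z‖ = ρ := by simpa using hz
    exact hz ▸ Complex.abs_im_le_norm z



/-! ### Gaussian measure -/

/-- The standard Gaussian measure. -/
abbrev gam (n : ℕ) : Measure (E n) := ProbabilityTheory.stdGaussian (E n)

theorem gam_comb (a b e : ℝ) (h : a ^ 2 + b ^ 2 = e ^ 2) :
    ((gam n).prod (gam n)).map (fun p => a • p.1 + b • p.2) = (gam n).map (fun v => e • v) := by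
  have hp : IsProbabilityMeasure (((gam n).prod (gam n)).map (fun p : E n × E n => a • p.1 + b • p.2)) :=
    Measure.isProbabilityMeasure_map (by fun_prop)
  have hp' : IsProbabilityMeasure ((gam n).map (fun v : E n => e • v)) :=
    Measure.isProbabilityMeasure_map (by fun_prop)
  apply Measure.ext_of_charFun
  ext t
  rw [charFun_map_smul, ProbabilityTheory.charFun_stdGaussian, charFun_apply,
    integral_map (by fun_prop) (by fun_prop)]
  have h1 : ∀ p : E n × E n, Complex.exp (⟪a • p.1 + b • p.2, t⟫ * Complex.I) =
      Complex.exp (⟪p.1, a • t⟫ * Complex.I) * Complex.exp (⟪p.2, b • t⟫ * Complex.I) := by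
    intro p
    rw [← Complex.exp_add, inner_add_left, real_inner_smul_left, real_inner_smul_left,
      real_inner_smul_right, real_inner_smul_right]
    push_cast; ring_nf
  simp_rw [h1]
  rw [integral_prod_mul (fun u : E n => Complex.exp (⟪u, a • t⟫ * Complex.I))
    (fun u : E n => Complex.exp (⟪u, b • t⟫ * Complex.I)), ← charFun_apply, ← charFun_apply,
    ProbabilityTheory.charFun_stdGaussian, ProbabilityTheory.charFun_stdGaussian, ← Complex.exp_add]
  congr 1
  rw [norm_smul, norm_smul, norm_smul]
  norm_cast
  rw [mul_pow, mul_pow, mul_pow, norm_eq_abs, norm_eq_abs, norm_eq_abs, sq_abs, sq_abs, sq_abs, ← h]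
  ring

theorem gam_comb_one (a b : ℝ) (h : a ^ 2 + b ^ 2 = 1) :
    ((gam n).prod (gam n)).map (fun p => a • p.1 + b • p.2) = gam n := by
  rw [gam_comb a b 1 (by rw [h]; norm_num)]; simp

theorem gam_rot (s c : ℝ) (h : s ^ 2 + c ^ 2 = 1) :
    ((gam n).prod (gam n)).map (fun p : E n × E n => (s • p.1 + c • p.2, c • p.1 - s • p.2)) =
      (gam n).prod (gam n) := by
  set L : E n × E n →L[ℝ] E n × E n :=
    (s • ContinuousLinearMap.fst ℝ (E n) (E n) + c • ContinuousLinearMap.snd ℝ (E n) (E n)).prod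
     (c • ContinuousLinearMap.fst ℝ (E n) (E n) - s • ContinuousLinearMap.snd ℝ (E n) (E n)) with hL
  have hf : (fun p : E n × E n => (s • p.1 + c • p.2, c • p.1 - s • p.2)) = L := by
    ext p <;> simp [hL]
  rw [hf]
  have hp : IsProbabilityMeasure (((gam n).prod (gam n)).map L) :=
    Measure.isProbabilityMeasure_map (by fun_prop)
  apply Measure.ext_of_charFunDual
  ext M
  rw [charFunDual_map, charFunDual_prod, charFunDual_prod]
  obtain ⟨a, ha⟩ := (InnerProductSpace.toDual ℝ (E n)).surjective (M.comp (.inl ℝ (E n) (E n)))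
  obtain ⟨b, hb⟩ := (InnerProductSpace.toDual ℝ (E n)).surjective (M.comp (.inr ℝ (E n) (E n)))
  have hM : ∀ p : E n × E n, M p = ⟪a, p.1⟫ + ⟪b, p.2⟫ := by
    intro p
    have h1 : ⟪a, p.1⟫ = M (p.1, 0) := by
      rw [← InnerProductSpace.toDual_apply_apply (𝕜 := ℝ), ha]; simp
    have h2 : ⟪b, p.2⟫ = M (0, p.2) := by
      rw [← InnerProductSpace.toDual_apply_apply (𝕜 := ℝ), hb]; simp
    rw [h1, h2, ← map_add]; simp
  have h1 : (M.comp L).comp (.inl ℝ (E n) (E n)) = InnerProductSpace.toDual ℝ (E n) (s • a + c • b) := by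
    ext x
    simp [hL, hM, inner_add_left, real_inner_smul_left, real_inner_smul_right]
  have h2 : (M.comp L).comp (.inr ℝ (E n) (E n)) = InnerProductSpace.toDual ℝ (E n) (c • a - s • b) := by
    ext x
    simp [hL, hM, inner_sub_left, real_inner_smul_left, real_inner_smul_right]
    ring
  rw [h1, h2, ← ha, ← hb]
  simp only [ProbabilityTheory.charFunDual_stdGaussian, ← Complex.exp_add, LinearIsometryEquiv.norm_map]
  congr 1
  norm_cast
  rw [norm_add_sq_real, norm_sub_sq_real]
  simp only [norm_smul, real_inner_smul_left, real_inner_smul_right, mul_pow, norm_eq_abs, sq_abs]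
  have h3 : c ^ 2 = 1 - s ^ 2 := by linarith
  rw [h3]
  ring

theorem gam_memLp_id (p : ℝ≥0∞) (hp : p ≠ ⊤) : MemLp (fun x : E n => x) p (gam n) :=
  ProbabilityTheory.IsGaussian.memLp_id (gam n) p hp

theorem gam_integrable_norm : Integrable (fun x : E n => ‖x‖) (gam n) :=
  ((gam_memLp_id 1 (by simp)).integrable le_rfl).norm

theorem gam_integrable_lin {F : E n → ℝ} (hF : AEStronglyMeasurable F (gam n)) (c : ℝ)
    (h : ∀ x, |F x| ≤ c * ‖x‖) : Integrable F (gam n) :=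
  (gam_integrable_norm.const_mul c).mono' hF (ae_of_all _ h)

/-- exchangeability -/
theorem gam_swap {F : E n × E n → ℝ} (hF : Measurable F) (s c : ℝ) (h : s ^ 2 + c ^ 2 = 1) :
    ∫ p : E n × E n, F (s • p.1 + c • p.2, p.1) ∂((gam n).prod (gam n)) =
      ∫ p : E n × E n, F (p.1, s • p.1 + c • p.2) ∂((gam n).prod (gam n)) := by
  conv_rhs => rw [← gam_rot s c h]
  rw [integral_map (by fun_prop)
    (Measurable.aestronglyMeasurable (f := fun p : E n × E n => F (p.1, s • p.1 + c • p.2))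
      (hF.comp (by fun_prop)))]
  congr 1; ext p
  congr 2
  rw [smul_add, smul_sub, smul_smul, smul_smul, smul_smul, smul_smul, mul_comm c s]
  have : p.1 = (s * s + c * c) • p.1 := by rw [show s * s + c * c = 1 by linarith]; simp
  conv_lhs => rw [this]
  rw [add_smul]; abel

theorem gam_marg {F : E n → ℝ} (hF : Measurable F) (s c : ℝ) (h : s ^ 2 + c ^ 2 = 1) :
    ∫ p : E n × E n, F (s • p.1 + c • p.2) ∂((gam n).prod (gam n)) = ∫ u, F u ∂(gam n) := by
  conv_rhs => rw [← gam_comb_one s c h]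
  rw [integral_map (by fun_prop) (by fun_prop)]



/-! ### Mehler expansion -/

/-- normalized character -/
def chr (a x : E n) : ℂ := Complex.exp (⟪x, a⟫ * Complex.I + (‖a‖ ^ 2 / 2 : ℝ))

theorem chr_cont (a : E n) : Continuous (chr a) := by
  unfold chr; fun_prop

theorem chr_norm (a x : E n) : ‖chr a x‖ = Real.exp (‖a‖ ^ 2 / 2) := by
  rw [chr, Complex.norm_exp]; simp [← Complex.ofReal_pow]

theorem chr_int (s c : ℝ) (h : s ^ 2 + c ^ 2 = 1) (a b : E n) :
    ∫ p : E n × E n, chr a (s • p.1 + c • p.2) * (starRingEnd ℂ) (chr b p.1) ∂((gam n).prod (gam n))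
      = Complex.exp (s * ⟪a, b⟫ : ℝ) := by
  have h1 : ∀ p : E n × E n, chr a (s • p.1 + c • p.2) * (starRingEnd ℂ) (chr b p.1) =
      Complex.exp ((‖a‖ ^ 2 / 2 + ‖b‖ ^ 2 / 2 : ℝ)) * (
      Complex.exp (⟪p.1, s • a - b⟫ * Complex.I) * Complex.exp (⟪p.2, c • a⟫ * Complex.I)) := by
    intro p
    rw [chr, chr, ← Complex.exp_conj, ← Complex.exp_add, ← Complex.exp_add, ← Complex.exp_add]
    congr 1
    simp only [map_add, map_mul, Complex.conj_ofReal, Complex.conj_I, inner_add_left,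
      real_inner_smul_left, inner_sub_right, real_inner_smul_right]
    push_cast; ring
  simp_rw [h1]
  rw [integral_const_mul, integral_prod_mul (fun u : E n => Complex.exp (⟪u, s • a - b⟫ * Complex.I))
    (fun u : E n => Complex.exp (⟪u, c • a⟫ * Complex.I)), ← charFun_apply, ← charFun_apply,
    ProbabilityTheory.charFun_stdGaussian, ProbabilityTheory.charFun_stdGaussian, ← Complex.exp_add,
    ← Complex.exp_add]
  congr 1
  norm_cast
  rw [norm_sub_sq_real, norm_smul, norm_smul, real_inner_smul_left, mul_pow, mul_pow, norm_eq_abs,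
    norm_eq_abs, sq_abs, sq_abs]
  have h3 : c ^ 2 = 1 - s ^ 2 := by linarith
  rw [h3]
  ring

/-- trigonometric polynomial -/
def tp (α : E n →₀ ℂ) (x : E n) : ℂ := α.sum fun a z => z * chr a x

theorem tp_cont (α : E n →₀ ℂ) : Continuous (tp α) := by
  unfold tp Finsupp.sum
  exact continuous_finset_sum _ fun a _ => continuous_const.mul (chr_cont a)

theorem tp_bdd (α : E n →₀ ℂ) : ∃ B : ℝ, ∀ x, ‖tp α x‖ ≤ B := by
  refine ⟨∑ a ∈ α.support, ‖α a‖ * Real.exp (‖a‖ ^ 2 / 2), fun x => ?_⟩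
  refine (norm_sum_le _ _).trans (le_of_eq ?_)
  simp only [norm_mul, chr_norm]

/-- Taylor coefficients -/
def tA (α β : E n →₀ ℂ) (k : ℕ) : ℂ :=
  ∑ a ∈ α.support, ∑ b ∈ β.support, α a * (starRingEnd ℂ) (β b) * ((⟪a, b⟫ ^ k / k.factorial : ℝ) : ℂ)

theorem bdd_integrable {Ω : Type*} [MeasurableSpace Ω] {μ : Measure Ω} [IsFiniteMeasure μ]
    {F : Type*} [NormedAddCommGroup F] {f : Ω → F}
    (hf : AEStronglyMeasurable f μ) (B : ℝ) (hB : ∀ x, ‖f x‖ ≤ B) : Integrable f μ :=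
  (integrable_const B).mono' hf (ae_of_all _ hB)

theorem tp_int (s c : ℝ) (h : s ^ 2 + c ^ 2 = 1) (α β : E n →₀ ℂ) :
    HasSum (fun k => tA α β k * (s : ℂ) ^ k)
     (∫ p : E n × E n, tp α (s • p.1 + c • p.2) * (starRingEnd ℂ) (tp β p.1)
      ∂((gam n).prod (gam n))) := by
  have e1 : (∫ p : E n × E n, tp α (s • p.1 + c • p.2) * (starRingEnd ℂ) (tp β p.1)
      ∂((gam n).prod (gam n))) = ∑ a ∈ α.support, ∑ b ∈ β.support,
        α a * (starRingEnd ℂ) (β b) * Complex.exp (s * ⟪a, b⟫ : ℝ) := by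
    have hi : ∀ a b, Integrable (fun p : E n × E n => α a * (starRingEnd ℂ) (β b) *
        (chr a (s • p.1 + c • p.2) * (starRingEnd ℂ) (chr b p.1))) ((gam n).prod (gam n)) := by
      intro a b
      apply Integrable.const_mul
      refine bdd_integrable (Continuous.aestronglyMeasurable ?_)
        (Real.exp (‖a‖ ^ 2 / 2) * Real.exp (‖b‖ ^ 2 / 2)) ?_
      · have := chr_cont a; have := chr_cont b
        fun_prop
      · intro p; rw [norm_mul, RCLike.norm_conj, chr_norm, chr_norm]
    have h2 : ∀ p : E n × E n, tp α (s • p.1 + c • p.2) * (starRingEnd ℂ) (tp β p.1) =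
        ∑ a ∈ α.support, ∑ b ∈ β.support, α a * (starRingEnd ℂ) (β b) *
        (chr a (s • p.1 + c • p.2) * (starRingEnd ℂ) (chr b p.1)) := by
      intro p
      simp only [tp, Finsupp.sum, map_sum, map_mul, Finset.sum_mul_sum]
      refine Finset.sum_congr rfl fun a _ => Finset.sum_congr rfl fun b _ => by ring
    simp_rw [h2]
    rw [integral_finsetSum _ fun a _ => integrable_finsetSum _ fun b _ => hi a b]
    refine Finset.sum_congr rfl fun a _ => ?_
    rw [integral_finsetSum _ fun b _ => hi a b]
    refine Finset.sum_congr rfl fun b _ => ?_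
    rw [integral_const_mul, chr_int s c h]
  rw [e1]
  simp only [tA, Finset.sum_mul]
  refine hasSum_sum fun a _ => hasSum_sum fun b _ => ?_
  have h3 : HasSum (fun j : ℕ => ((s * ⟪a, b⟫ : ℝ) : ℂ) ^ j / j.factorial) (Complex.exp (s * ⟪a, b⟫ : ℝ)) := by
    rw [Complex.exp_eq_exp_ℂ]; exact NormedSpace.expSeries_div_hasSum_exp _
  have h4 := h3.mul_left (α a * (starRingEnd ℂ) (β b))
  refine h4.congr_fun ?_ |> fun h => h
  intro k
  push_cast; ring

/-- multi-index coefficient -/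
def cw (α : E n →₀ ℂ) (k : ℕ) (w : Fin k → Fin n) : ℂ :=
  ∑ a ∈ α.support, α a * ((∏ j, a (w j) : ℝ) : ℂ)

theorem tA_eq (α β : E n →₀ ℂ) (k : ℕ) :
    tA α β k = (1 / k.factorial : ℝ) * ∑ w : Fin k → Fin n, cw α k w * (starRingEnd ℂ) (cw β k w) := by
  have h1 : ∀ a b : E n, ⟪a, b⟫ ^ k = ∑ w : Fin k → Fin n, (∏ j, a (w j)) * ∏ j, b (w j) := by
    intro a b
    rw [PiLp.inner_apply, Fintype.sum_pow]
    refine Finset.sum_congr rfl fun w _ => ?_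
    rw [← Finset.prod_mul_distrib]
    refine Finset.prod_congr rfl fun i _ => ?_
    simp [mul_comm]
  simp only [tA, cw, map_sum, Finset.sum_mul_sum, map_mul, Complex.conj_ofReal, h1]
  rw [Finset.sum_comm, Finset.mul_sum]
  have h2 : ∀ a, ∑ w : Fin k → Fin n, ∑ b ∈ β.support, α a * ((∏ j, a (w j) : ℝ) : ℂ) *
      ((starRingEnd ℂ) (β b) * ((∏ j, b (w j) : ℝ) : ℂ)) =
      ∑ b ∈ β.support, α a * (starRingEnd ℂ) (β b) *
        ((∑ w : Fin k → Fin n, (∏ j, a (w j)) * ∏ j, b (w j) : ℝ) : ℂ) := by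
    intro a
    rw [Finset.sum_comm]
    refine Finset.sum_congr rfl fun b _ => ?_
    push_cast
    rw [Finset.mul_sum]
    refine Finset.sum_congr rfl fun w _ => by ring
  rw [← Finset.mul_sum, Finset.sum_comm]
  rw [Finset.sum_comm (s := (Finset.univ : Finset (Fin k → Fin n)))]
  simp only [h2]
  rw [Finset.mul_sum]
  refine Finset.sum_congr rfl fun a _ => ?_
  rw [Finset.mul_sum]
  refine Finset.sum_congr rfl fun b _ => ?_
  push_cast; ring

theorem tA_norm (α β : E n →₀ ℂ) (k : ℕ) :
    ‖tA α β k‖ ≤ ((tA α α k).re + (tA β β k).re) / 2 := by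
  have h1 : ∀ α : E n →₀ ℂ, (tA α α k).re = (1 / k.factorial : ℝ) * ∑ w : Fin k → Fin n, ‖cw α k w‖ ^ 2 := by
    intro α
    rw [tA_eq]
    simp only [Complex.mul_conj, Complex.normSq_eq_norm_sq]
    rw [← Complex.ofReal_sum, ← Complex.ofReal_mul, Complex.ofReal_re]
  rw [h1, h1, tA_eq, norm_mul, Complex.norm_real, Real.norm_of_nonneg (by positivity), ← mul_add,
    mul_div_assoc]
  gcongr
  refine (norm_sum_le _ _).trans ?_
  rw [← Finset.sum_add_distrib, Finset.sum_div]
  gcongr with w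
  rw [norm_mul, RCLike.norm_conj]
  nlinarith [sq_nonneg (‖cw α k w‖ - ‖cw β k w‖)]

theorem tA_self (α : E n →₀ ℂ) :
    HasSum (fun k => (tA α α k).re) (∫ x, ‖tp α x‖ ^ 2 ∂(gam n)) := by
  have h := tp_int 1 0 (by norm_num) α α
  simp only [one_smul, zero_smul, add_zero, Complex.mul_conj, Complex.normSq_eq_norm_sq] at h
  rw [integral_fun_fst (fun x : E n => ((‖tp α x‖ ^ 2 : ℝ) : ℂ))] at h
  have h2 := Complex.reCLM.hasSum h
  have h3 : (∫ x, ((‖tp α x‖ ^ 2 : ℝ) : ℂ) ∂(gam n)) = ((∫ x, ‖tp α x‖ ^ 2 ∂(gam n) : ℝ) : ℂ) :=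
    integral_ofReal
  rw [h3] at h2
  simpa using h2

theorem chr_mom (a : E n) (j : Fin n) : ∫ x, chr a x * ((x j : ℝ) : ℂ) ∂(gam n) = Complex.I * (a j : ℝ) := by
  have h := iteratedFDeriv_charFun (μ := gam n) (n := 1) (t := a)
    (gam_memLp_id (((1 : ℕ) : ℝ≥0∞)) (by simp)) (fun _ => EuclideanSpace.single j 1)
  rw [iteratedFDeriv_one_apply] at h
  have hc : charFun (gam n) = fun t : E n => ((Real.exp (-‖t‖ ^ 2 / 2) : ℝ) : ℂ) := by
    ext t; rw [ProbabilityTheory.charFun_stdGaussian]; push_cast; rfl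
  have hd : HasFDerivAt (fun t : E n => ((Real.exp (-‖t‖ ^ 2 / 2) : ℝ) : ℂ))
      (Complex.ofRealCLM.comp (Real.exp (-‖a‖ ^ 2 / 2) • ((-1 / 2 : ℝ) • (2 • innerSL ℝ a)))) a := by
    have h1 : HasFDerivAt (fun t : E n => (-1 / 2 : ℝ) • ‖t‖ ^ 2) ((-1 / 2 : ℝ) • (2 • innerSL ℝ a)) a :=
      HasFDerivAt.const_smul (hasStrictFDerivAt_norm_sq a).hasFDerivAt (-1 / 2 : ℝ)
    have h2 : HasFDerivAt (fun t : E n => -‖t‖ ^ 2 / 2) ((-1 / 2 : ℝ) • (2 • innerSL ℝ a)) a := by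
      refine h1.congr_of_eventuallyEq (Filter.Eventually.of_forall fun t => ?_)
      simp only [smul_eq_mul]; ring
    exact Complex.ofRealCLM.hasFDerivAt.comp a h2.exp
  rw [hc, hd.fderiv] at h
  have e1 : ∀ x : E n, chr a x * ((x j : ℝ) : ℂ) = ((Real.exp (‖a‖ ^ 2 / 2) : ℝ) : ℂ) *
      (((∏ i : Fin 1, ⟪x, EuclideanSpace.single j (1:ℝ)⟫ : ℝ)) * Complex.exp (⟪x, a⟫ * Complex.I)) := by
    intro x
    rw [chr, Complex.exp_add]
    simp only [Finset.univ_unique, Finset.prod_const, Finset.card_singleton, pow_one]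
    rw [EuclideanSpace.inner_single_right]
    push_cast
    simp
    ring
  simp_rw [e1]
  rw [integral_const_mul]
  push_cast at h ⊢
  simp only [pow_one] at h
  have h3 : (∫ x : E n, (∏ i : Fin 1, ((⟪x, EuclideanSpace.single j (1:ℝ)⟫ : ℝ) : ℂ)) *
      Complex.exp (⟪x, a⟫ * Complex.I) ∂(gam n)) = Complex.I * (a j : ℝ) * ((Real.exp (-‖a‖ ^ 2 / 2) : ℝ) : ℂ) := by
    have h4 := congrArg (fun z => -Complex.I * z) h
    simp only [← mul_assoc, neg_mul, Complex.I_mul_I, neg_neg, one_mul] at h4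
    rw [← h4]
    simp [EuclideanSpace.inner_single_right]
    ring
  rw [h3]
  have h5 : Complex.exp ((‖a‖ : ℂ) ^ 2 / 2) * Complex.exp (-(‖a‖:ℂ) ^ 2 / 2) = 1 := by
    rw [← Complex.exp_add, ← Complex.exp_zero]; congr 1; ring
  push_cast
  linear_combination (Complex.I * (a j : ℝ)) * h5

theorem tA_one (α β : E n →₀ ℂ) :
    tA α β 1 = ∑ j, (∫ x, tp α x * ((x j : ℝ) : ℂ) ∂(gam n)) *
      (starRingEnd ℂ) (∫ x, tp β x * ((x j : ℝ) : ℂ) ∂(gam n)) := by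
  have h1 : ∀ α : E n →₀ ℂ, ∀ j, (∫ x, tp α x * ((x j : ℝ) : ℂ) ∂(gam n)) =
      Complex.I * ∑ a ∈ α.support, α a * (a j : ℝ) := by
    intro α j
    have hi : ∀ a, Integrable (fun x : E n => α a * (chr a x * ((x j : ℝ) : ℂ))) (gam n) := by
      intro a
      apply Integrable.const_mul
      refine (gam_integrable_norm.const_mul (Real.exp (‖a‖ ^ 2 / 2))).mono' ?_ (ae_of_all _ fun x => ?_)
      · have := chr_cont a
        exact Continuous.aestronglyMeasurable (by fun_prop)
      · rw [norm_mul, chr_norm, Complex.norm_real]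
        gcongr
        exact PiLp.norm_apply_le x j
    simp only [tp, Finsupp.sum, Finset.sum_mul, mul_assoc]
    rw [integral_finsetSum _ fun a _ => hi a, Finset.mul_sum]
    refine Finset.sum_congr rfl fun a _ => ?_
    rw [integral_const_mul, chr_mom]; ring
  simp only [h1, map_mul, Complex.conj_I, map_sum, Complex.conj_ofReal]
  have h2 : ∀ p q : ℂ, Complex.I * p * (-Complex.I * q) = p * q := by
    intro p q; linear_combination (-p * q) * Complex.I_mul_I
  simp only [h2, Finset.sum_mul_sum]
  rw [Finset.sum_comm]
  simp only [tA]
  refine Finset.sum_congr rfl fun a _ => ?_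
  rw [Finset.sum_comm]
  refine Finset.sum_congr rfl fun b _ => ?_
  rw [PiLp.inner_apply]
  simp only [pow_one, Nat.factorial_one, Nat.cast_one, div_one]
  push_cast
  rw [Finset.mul_sum]
  refine Finset.sum_congr rfl fun w _ => ?_
  simp
  ring



/-! ### Density of characters and the Mehler expansion of bounded functions -/

theorem real_fourier_zero (r : E n → ℝ) (hr : Integrable r (gam n))
    (h : ∀ a : E n, ∫ x, (r x : ℂ) * Complex.exp (⟪x, a⟫ * Complex.I) ∂(gam n) = 0) :
    r =ᵐ[gam n] 0 := by
  have hp : AEMeasurable (fun x => ENNReal.ofReal (r x)) (gam n) := hr.aemeasurable.ennreal_ofReal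
  have hm : AEMeasurable (fun x => ENNReal.ofReal (-r x)) (gam n) := hr.aemeasurable.neg.ennreal_ofReal
  have fp : ∫⁻ x, ENNReal.ofReal (r x) ∂(gam n) ≠ ⊤ := hr.lintegral_lt_top.ne
  have fm : ∫⁻ x, ENNReal.ofReal (-r x) ∂(gam n) ≠ ⊤ := hr.neg.lintegral_lt_top.ne
  have i1 : IsFiniteMeasure ((gam n).withDensity fun x => ENNReal.ofReal (r x)) :=
    isFiniteMeasure_withDensity fp
  have i2 : IsFiniteMeasure ((gam n).withDensity fun x => ENNReal.ofReal (-r x)) :=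
    isFiniteMeasure_withDensity fm
  have key : (gam n).withDensity (fun x => ENNReal.ofReal (r x)) =
      (gam n).withDensity (fun x => ENNReal.ofReal (-r x)) := by
    apply Measure.ext_of_charFun
    ext a
    rw [charFun_apply, charFun_apply,
      integral_withDensity_eq_integral_toReal_smul₀ hp (by simp),
      integral_withDensity_eq_integral_toReal_smul₀ hm (by simp), ← sub_eq_zero, ← integral_sub]
    · rw [← h a]
      congr 1; ext x
      simp only [Complex.real_smul]
      rw [← sub_mul]
      congr 1
      rw [← Complex.ofReal_sub]
      congr 1
      rcases le_total 0 (r x) with h0 | h0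
      · rw [ENNReal.toReal_ofReal h0, ENNReal.ofReal_of_nonpos (by linarith)]; simp
      · rw [ENNReal.toReal_ofReal (by linarith : 0 ≤ -r x), ENNReal.ofReal_of_nonpos h0]; simp
    · refine hr.norm.mono' (by fun_prop) (ae_of_all _ fun x => ?_)
      rw [norm_smul, Complex.norm_exp_ofReal_mul_I, mul_one]
      rw [ENNReal.toReal_ofReal', Real.norm_eq_abs, Real.norm_eq_abs, abs_of_nonneg (le_max_right _ _)]
      exact max_le (le_abs_self _) (abs_nonneg _)
    · refine hr.norm.mono' (by fun_prop) (ae_of_all _ fun x => ?_)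
      rw [norm_smul, Complex.norm_exp_ofReal_mul_I, mul_one]
      rw [ENNReal.toReal_ofReal', Real.norm_eq_abs, Real.norm_eq_abs, abs_of_nonneg (le_max_right _ _)]
      exact max_le (neg_le_abs _) (abs_nonneg _)
  rw [withDensity_eq_iff hp hm fp] at key
  filter_upwards [key] with x hx
  rcases le_total 0 (r x) with h0 | h0
  · rw [ENNReal.ofReal_of_nonpos (by linarith : -r x ≤ 0), ENNReal.ofReal_eq_zero] at hx
    exact le_antisymm hx h0
  · rw [ENNReal.ofReal_of_nonpos h0, eq_comm, ENNReal.ofReal_eq_zero] at hx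
    show r x = 0
    linarith

theorem cplx_fourier_zero (r : E n → ℂ) (hr : Integrable r (gam n))
    (h : ∀ a : E n, ∫ x, r x * Complex.exp (⟪x, a⟫ * Complex.I) ∂(gam n) = 0) :
    r =ᵐ[gam n] 0 := by
  have hi : ∀ (q : E n → ℂ), Integrable q (gam n) → ∀ a : E n,
      Integrable (fun x => q x * Complex.exp (⟪x, a⟫ * Complex.I)) (gam n) := by
    intro q hq a
    refine hq.norm.mono' (by fun_prop) (ae_of_all _ fun x => ?_)
    rw [norm_mul, Complex.norm_exp_ofReal_mul_I, mul_one]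
  have h' : ∀ a : E n, ∫ x, (starRingEnd ℂ) (r x) * Complex.exp (⟪x, a⟫ * Complex.I) ∂(gam n) = 0 := by
    intro a
    have h1 := congrArg (starRingEnd ℂ) (h (-a))
    rw [← integral_conj, map_zero] at h1
    rw [← h1]
    congr 1; ext x
    rw [map_mul, ← Complex.exp_conj]
    simp
  have hrc : Integrable (fun x => (starRingEnd ℂ) (r x)) (gam n) :=
    hr.norm.mono' (Complex.continuous_conj.comp_aestronglyMeasurable hr.1) (ae_of_all _ fun x => by simp)
  have hre : (fun x => (r x).re) =ᵐ[gam n] 0 := by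
    apply real_fourier_zero _ hr.re
    intro a
    have : ∀ x, (((r x).re : ℝ) : ℂ) * Complex.exp (⟪x, a⟫ * Complex.I) =
       (1/2) * (r x * Complex.exp (⟪x, a⟫ * Complex.I) +
        (starRingEnd ℂ) (r x) * Complex.exp (⟪x, a⟫ * Complex.I)) := by
      intro x; rw [Complex.re_eq_add_conj]; ring
    refine (integral_congr_ae (ae_of_all _ this)).trans ?_
    rw [integral_const_mul, integral_add (hi _ hr a) (hi _ hrc a), h, h']; simp
  have him : (fun x => (r x).im) =ᵐ[gam n] 0 := by
    apply real_fourier_zero _ hr.im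
    intro a
    have : ∀ x, (((r x).im : ℝ) : ℂ) * Complex.exp (⟪x, a⟫ * Complex.I) =
       (1/(2 * Complex.I)) * (r x * Complex.exp (⟪x, a⟫ * Complex.I) -
        (starRingEnd ℂ) (r x) * Complex.exp (⟪x, a⟫ * Complex.I)) := by
      intro x; rw [Complex.im_eq_sub_conj]; ring
    refine (integral_congr_ae (ae_of_all _ this)).trans ?_
    rw [integral_const_mul, integral_sub (hi _ hr a) (hi _ hrc a), h, h']; simp
  filter_upwards [hre, him] with x h1 h2
  exact Complex.ext h1 h2

theorem tp_memLp (α : E n →₀ ℂ) : MemLp (tp α) 2 (gam n) := by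
  obtain ⟨B, hB⟩ := tp_bdd α
  exact MemLp.of_bound (tp_cont α).aestronglyMeasurable B (ae_of_all _ hB)

theorem tp_dense (F : Lp ℂ 2 (gam n)) :
    ∃ α : ℕ → (E n →₀ ℂ), Filter.Tendsto (fun j => (tp_memLp (α j)).toLp) Filter.atTop (nhds F) := by
  have hc : ∀ a : E n, MemLp (chr a) 2 (gam n) := fun a =>
    MemLp.of_bound (chr_cont a).aestronglyMeasurable _ (ae_of_all _ fun x => (chr_norm a x).le)
  set M : Submodule ℂ (Lp ℂ 2 (gam n)) := Submodule.span ℂ (Set.range fun a => (hc a).toLp) with hM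
  have hdense : M.topologicalClosure = ⊤ := by
    rw [Submodule.topologicalClosure_eq_top_iff, Submodule.eq_bot_iff]
    intro g hg
    rw [Submodule.mem_orthogonal] at hg
    have hgi : Integrable g (gam n) := (Lp.memLp g).integrable (by norm_num)
    have h0 : (g : E n → ℂ) =ᵐ[gam n] 0 := by
      apply cplx_fourier_zero _ hgi
      intro a
      have h1 := hg (MemLp.toLp _ (hc (-a))) (Submodule.subset_span ⟨-a, rfl⟩)
      rw [L2.inner_def] at h1
      have h2 : ∫ x, g x * Complex.exp (⟪x, a⟫ * Complex.I) ∂(gam n) =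
          ((Real.exp (-(‖a‖ ^ 2 / 2)) : ℝ) : ℂ) * ∫ x, inner ℂ ((MemLp.toLp _ (hc (-a)) : Lp ℂ 2 (gam n)) x) (g x) ∂(gam n) := by
        rw [← integral_const_mul]
        apply integral_congr_ae
        filter_upwards [(hc (-a)).coeFn_toLp] with x hx
        rw [hx, chr, RCLike.inner_apply, ← Complex.exp_conj, Complex.ofReal_exp]
        rw [mul_left_comm, ← Complex.exp_add]
        congr 2
        simp only [map_add, map_mul, Complex.conj_ofReal, Complex.conj_I, inner_neg_right, norm_neg]
        push_cast; ring
      rw [h2, h1, mul_zero]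
    exact (Lp.eq_zero_iff_ae_eq_zero).2 h0
  have hF : F ∈ closure (M : Set (Lp ℂ 2 (gam n))) := by
    rw [← Submodule.topologicalClosure_coe, hdense]; trivial
  obtain ⟨x, hx, hxF⟩ := mem_closure_iff_seq_limit.1 hF
  have h3 : ∀ j, ∃ α : E n →₀ ℂ, (tp_memLp α).toLp = x j := by
    intro j
    obtain ⟨α, hα⟩ := (Finsupp.mem_span_range_iff_exists_finsupp).1 (hx j)
    refine ⟨α, ?_⟩
    rw [← hα]
    apply Lp.ext
    refine (MemLp.coeFn_toLp _).trans ?_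
    clear hα
    symm
    induction α using Finsupp.induction_linear with
    | zero => 
      simp only [Finsupp.sum_zero_index]
      filter_upwards [Lp.coeFn_zero ℂ 2 (gam n)] with x hx
      rw [hx]; simp [tp]
    | add f g hf hg =>
      rw [Finsupp.sum_add_index' (by simp) (by intros; rw [add_smul])]
      filter_upwards [Lp.coeFn_add (f.sum fun i a => a • (hc i).toLp) (g.sum fun i a => a • (hc i).toLp), hf, hg]
        with x h1 h2 h3
      rw [h1, Pi.add_apply, h2, h3]
      unfold tp
      rw [Finsupp.sum_add_index' (by simp) (by intros; rw [add_mul])]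
    | single a z =>
      rw [Finsupp.sum_single_index (by simp)]
      filter_upwards [Lp.coeFn_smul z (hc a).toLp, (hc a).coeFn_toLp] with x h1 h2
      rw [h1, Pi.smul_apply, h2, tp, Finsupp.sum_single_index (by simp)]
      rfl
  choose α hα using h3
  exact ⟨α, by simpa only [hα] using hxF⟩

theorem mehler (f g : E n → ℝ) (hf : Measurable f) (hg : Measurable g) (hf1 : ∀ x, |f x| ≤ 1)
    (hg1 : ∀ x, |g x| ≤ 1) : ∃ A : ℕ → ℂ, Summable (fun k => ‖A k‖) ∧ ∑' k, ‖A k‖ ≤ 1 ∧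
    A 1 = ((∑ j, (∫ x, f x * x j ∂(gam n)) * ∫ x, g x * x j ∂(gam n) : ℝ) : ℂ) ∧
    ∀ s c : ℝ, s ^ 2 + c ^ 2 = 1 → |s| < 1 →
      ((∫ p : E n × E n, f (s • p.1 + c • p.2) * g p.1 ∂((gam n).prod (gam n)) : ℝ) : ℂ) =
        ∑' k, A k * (s : ℂ) ^ k := by
  have hb : ∀ f : E n → ℝ, Measurable f → (∀ x, |f x| ≤ 1) →
      MemLp (fun x => (f x : ℂ)) 2 (gam n) := by
    intro f hf hf1
    refine MemLp.of_bound (by fun_prop) 1 (ae_of_all _ fun x => ?_)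
    rw [Complex.norm_real]; exact hf1 x
  have hL := hb f hf hf1
  have hG := hb g hg hg1
  set FF : Lp ℂ 2 (gam n) := MemLp.toLp _ hL with hFF
  set GG : Lp ℂ 2 (gam n) := MemLp.toLp _ hG with hGG
  have hn1 : ∀ f : E n → ℝ, ∀ (hL : MemLp (fun x => (f x : ℂ)) 2 (gam n)), (∀ x, |f x| ≤ 1) →
      ‖MemLp.toLp _ hL‖ ≤ 1 := by
    intro f hL hf1
    have := Lp.norm_le_of_ae_bound (f := MemLp.toLp _ hL) (C := 1) zero_le_one (by
      filter_upwards [hL.coeFn_toLp] with x hx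
      rw [hx, Complex.norm_real]; exact hf1 x)
    simpa [measureUnivNNReal] using this
  obtain ⟨α, hα⟩ := tp_dense FF
  obtain ⟨β, hβ⟩ := tp_dense GG
  -- norms
  have hnorm : ∀ α : E n →₀ ℂ, ∫ x, ‖tp α x‖ ^ 2 ∂(gam n) = ‖MemLp.toLp _ (tp_memLp α)‖ ^ 2 := by
    intro α
    rw [← inner_self_eq_norm_sq (𝕜 := ℂ), L2.inner_def, integral_congr_ae (g := fun x => ((‖tp α x‖ ^ 2 : ℝ) : ℂ))]
    · rw [show (∫ a, ((‖tp α a‖ ^ 2 : ℝ) : ℂ) ∂(gam n)) = ((∫ a, ‖tp α a‖ ^ 2 ∂(gam n) : ℝ) : ℂ) from integral_ofReal]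
      simp
    · filter_upwards [(tp_memLp α).coeFn_toLp] with x hx
      rw [hx, inner_self_eq_norm_sq_to_K]; simp
  have hsum : ∀ j N, ∑ k ∈ Finset.range N, ‖tA (α j) (β j) k‖ ≤
      (‖MemLp.toLp _ (tp_memLp (α j))‖ ^ 2 + ‖MemLp.toLp _ (tp_memLp (β j))‖ ^ 2) / 2 := by
    intro j N
    have h1 := ((tA_self (α j)).add (tA_self (β j))).div_const 2
    rw [hnorm, hnorm] at h1
    have h2 := sum_le_hasSum (Finset.range N) (fun k _ => (norm_nonneg _).trans (tA_norm (α j) (β j) k)) h1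
    exact (Finset.sum_le_sum fun k _ => tA_norm (α j) (β j) k).trans h2
  have hlim : Filter.Tendsto (fun j => (‖MemLp.toLp _ (tp_memLp (α j))‖ ^ 2 +
      ‖MemLp.toLp _ (tp_memLp (β j))‖ ^ 2) / 2) Filter.atTop (nhds ((‖FF‖ ^ 2 + ‖GG‖ ^ 2) / 2)) :=
    ((hα.norm.pow 2).add (hβ.norm.pow 2)).div_const 2
  obtain ⟨M, hM⟩ := hlim.bddAbove_range
  have hMb : ∀ j, (‖MemLp.toLp _ (tp_memLp (α j))‖ ^ 2 + ‖MemLp.toLp _ (tp_memLp (β j))‖ ^ 2) / 2 ≤ M :=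
    fun j => hM ⟨j, rfl⟩
  have hkM : ∀ j k, ‖tA (α j) (β j) k‖ ≤ M := fun j k =>
    ((Finset.single_le_sum (f := fun k => ‖tA (α j) (β j) k‖) (fun _ _ => norm_nonneg _)
      (Finset.self_mem_range_succ k)).trans (hsum j (k + 1))).trans (hMb j)
  have hcpt : IsCompact (Set.pi Set.univ fun _ : ℕ => Metric.closedBall (0 : ℂ) M) :=
    isCompact_univ_pi fun _ => isCompact_closedBall _ _
  obtain ⟨A, -, φ, hφ, hA⟩ := hcpt.tendsto_subseq (x := fun j k => tA (α j) (β j) k) (by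
    intro j k _; simpa using hkM j k)
  rw [tendsto_pi_nhds] at hA
  have hφt := hφ.tendsto_atTop
  have hAN : ∀ N, ∑ k ∈ Finset.range N, ‖A k‖ ≤ 1 := by
    intro N
    have h1 : (‖FF‖ ^ 2 + ‖GG‖ ^ 2) / 2 ≤ 1 := by
      have h2 := hn1 f hL hf1
      have h3 := hn1 g hG hg1
      have := norm_nonneg FF; have := norm_nonneg GG
      nlinarith
    refine le_trans ?_ h1
    exact le_of_tendsto_of_tendsto' (tendsto_finsetSum _ fun k _ => (hA k).norm) (hlim.comp hφt)
      fun j => hsum (φ j) N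
  have hAs : Summable fun k => ‖A k‖ :=
    summable_of_sum_range_le (fun _ => norm_nonneg _) hAN
  refine ⟨A, hAs, Real.tsum_le_of_sum_range_le (fun _ => norm_nonneg _) hAN, ?_, ?_⟩
  · -- first coefficient
    have hx : ∀ j : Fin n, MemLp (fun x : E n => ((x j : ℝ) : ℂ)) 2 (gam n) := by
      intro j
      refine (gam_memLp_id 2 (by simp)).of_le (by fun_prop) (ae_of_all _ fun x => ?_)
      rw [Complex.norm_real]; exact PiLp.norm_apply_le x j
    have hP : ∀ (f : E n → ℂ) (hf : MemLp f 2 (gam n)) (j : Fin n), ∫ x, f x * ((x j : ℝ) : ℂ) ∂(gam n) =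
        inner ℂ (MemLp.toLp _ (hx j)) (MemLp.toLp _ hf) := by
      intro f hf j
      rw [L2.inner_def]
      apply integral_congr_ae
      filter_upwards [(hx j).coeFn_toLp, hf.coeFn_toLp] with x h1 h2
      rw [h1, h2, RCLike.inner_apply]; simp
    have hlimj : Filter.Tendsto (fun i => tA (α (φ i)) (β (φ i)) 1) Filter.atTop
        (nhds (∑ j, inner ℂ (MemLp.toLp _ (hx j)) FF * (starRingEnd ℂ) (inner ℂ (MemLp.toLp _ (hx j)) GG))) := by
      simp only [tA_one, hP _ (tp_memLp _)]
      refine tendsto_finsetSum _ fun j _ => Filter.Tendsto.mul ?_ ?_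
      · exact (tendsto_const_nhds.inner hα).comp hφt
      · exact (Complex.continuous_conj.tendsto _).comp ((tendsto_const_nhds.inner hβ).comp hφt)
    rw [tendsto_nhds_unique (hA 1) hlimj]
    push_cast
    refine Finset.sum_congr rfl fun j _ => ?_
    rw [hFF, hGG, ← hP, ← hP]
    have h1 : ∀ f : E n → ℝ, ∫ x, (f x : ℂ) * ((x j : ℝ) : ℂ) ∂(gam n) = ((∫ x, f x * x j ∂(gam n) : ℝ) : ℂ) := by
      intro f
      rw [show ((∫ x, f x * x j ∂(gam n) : ℝ) : ℂ) = ∫ x, ((f x * x j : ℝ) : ℂ) ∂(gam n) from integral_ofReal.symm]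
      simp
    rw [h1, h1, Complex.conj_ofReal]
  · intro s c hsc hs
    have m1 : MeasurePreserving (fun p : E n × E n => s • p.1 + c • p.2) ((gam n).prod (gam n)) (gam n) :=
      ⟨by fun_prop, gam_comb_one s c hsc⟩
    have m2 : MeasurePreserving (fun p : E n × E n => p.1) ((gam n).prod (gam n)) (gam n) :=
      measurePreserving_fst
    have hQ : ∀ (f g : E n → ℂ) (hf : MemLp f 2 (gam n)) (hg : MemLp g 2 (gam n)),
        ∫ p : E n × E n, f (s • p.1 + c • p.2) * (starRingEnd ℂ) (g p.1) ∂((gam n).prod (gam n)) =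
        inner ℂ (Lp.compMeasurePreservingₗᵢ ℂ _ m2 (MemLp.toLp _ hg))
          (Lp.compMeasurePreservingₗᵢ ℂ _ m1 (MemLp.toLp _ hf)) := by
      intro f g hf hg
      rw [L2.inner_def]
      apply integral_congr_ae
      filter_upwards [Lp.coeFn_compMeasurePreserving (MemLp.toLp _ hg) m2,
        Lp.coeFn_compMeasurePreserving (MemLp.toLp _ hf) m1,
        m1.quasiMeasurePreserving.ae hf.coeFn_toLp, m2.quasiMeasurePreserving.ae hg.coeFn_toLp] with p h1 h2 h3 h4
      have e1 : (Lp.compMeasurePreservingₗᵢ ℂ _ m2 (MemLp.toLp _ hg)) p = g p.1 := h1.trans h4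
      have e2 : (Lp.compMeasurePreservingₗᵢ ℂ _ m1 (MemLp.toLp _ hf)) p = f (s • p.1 + c • p.2) := h2.trans h3
      rw [e1, e2, RCLike.inner_apply]
    have hl1 : Filter.Tendsto (fun i => ∑' k, tA (α (φ i)) (β (φ i)) k * (s : ℂ) ^ k) Filter.atTop
        (nhds (∑' k, A k * (s : ℂ) ^ k)) := by
      apply tendsto_tsum_of_dominated_convergence (bound := fun k => M * |s| ^ k)
      · exact (summable_geometric_of_lt_one (abs_nonneg _) hs).mul_left _
      · intro k; exact (hA k).mul_const _
      · refine Filter.Eventually.of_forall fun i k => ?_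
        rw [norm_mul, norm_pow, Complex.norm_real, Real.norm_eq_abs]
        gcongr
        exact hkM _ _
    have hl2 : Filter.Tendsto (fun i => ∑' k, tA (α (φ i)) (β (φ i)) k * (s : ℂ) ^ k) Filter.atTop
        (nhds (inner ℂ (Lp.compMeasurePreservingₗᵢ ℂ _ m2 GG)
          (Lp.compMeasurePreservingₗᵢ ℂ _ m1 FF))) := by
      have : ∀ i, ∑' k, tA (α (φ i)) (β (φ i)) k * (s : ℂ) ^ k = _ := fun i =>
        ((tp_int s c hsc (α (φ i)) (β (φ i))).tsum_eq).trans (hQ _ _ (tp_memLp _) (tp_memLp _))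
      simp only [this]
      refine Filter.Tendsto.inner ?_ ?_
      · exact ((LinearIsometry.continuous _).tendsto _).comp (hβ.comp hφt)
      · exact ((LinearIsometry.continuous _).tendsto _).comp (hα.comp hφt)
    rw [tendsto_nhds_unique hl1 hl2, hFF, hGG, ← hQ]
    refine (integral_ofReal (𝕜 := ℂ)).symm.trans ?_
    simp


/-! ### Sphere and Gaussian -/

theorem charFun_radial (σ : Measure (E n)) (hinv : ∀ e : E n ≃ₗᵢ[ℝ] E n, σ.map e = σ) (a b : E n)
    (h : ‖a‖ = ‖b‖) : charFun σ a = charFun σ b := by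
  set e := (ℝ ∙ (a - b))ᗮ.reflection with he
  have hab : e a = b := Submodule.reflection_sub h
  rw [← hab, charFun_apply, charFun_apply]
  conv_rhs => rw [← hinv e]
  rw [integral_map (by fun_prop) (by fun_prop)]
  simp only [LinearIsometryEquiv.inner_map_map]

theorem polar_law (σ : Measure (E n)) [IsProbabilityMeasure σ]
    (hinv : ∀ e : E n ≃ₗᵢ[ℝ] E n, σ.map e = σ) (hs : ∀ᵐ θ ∂σ, ‖θ‖ = 1) :
    ((gam n).prod σ).map (fun p : E n × E n => ‖p.1‖ • p.2) = gam n := by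
  have i1 : IsProbabilityMeasure (((gam n).prod σ).map (fun p : E n × E n => ‖p.1‖ • p.2)) :=
    Measure.isProbabilityMeasure_map (by fun_prop)
  apply Measure.ext_of_charFun
  ext t
  rw [charFun_apply, integral_map (by fun_prop) (by fun_prop)]
  have hb : ∀ (g : E n × E n → ℝ), Measurable g →
      Integrable (fun p => Complex.exp ((g p : ℂ) * Complex.I)) ((gam n).prod σ) := by
    intro g hg
    refine bdd_integrable (by fun_prop) 1 fun x => ?_
    rw [Complex.norm_exp_ofReal_mul_I]
  have h1 : ∀ g : E n, ∫ θ, Complex.exp ((inner ℝ (‖g‖ • θ) t : ℝ) * Complex.I) ∂σ =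
      ∫ θ, Complex.exp ((inner ℝ (‖t‖ • θ) g : ℝ) * Complex.I) ∂σ := by
    intro g
    have := charFun_radial σ hinv (‖g‖ • t) (‖t‖ • g) (by simp [norm_smul, mul_comm])
    rw [charFun_apply, charFun_apply] at this
    simpa only [inner_smul_left, inner_smul_right, RCLike.conj_to_real] using this
  rw [integral_prod _ (hb (fun p => inner ℝ (‖p.1‖ • p.2) t) (by fun_prop))]
  simp only [h1]
  rw [← integral_prod (f := fun p : E n × E n => Complex.exp ((inner ℝ (‖t‖ • p.2) p.1 : ℝ) * Complex.I))
    (hb (fun p => inner ℝ (‖t‖ • p.2) p.1) (by fun_prop)),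
    integral_prod_symm _ (hb (fun p => inner ℝ (‖t‖ • p.2) p.1) (by fun_prop))]
  have h2 : ∀ᵐ θ ∂σ, ∫ g, Complex.exp ((inner ℝ (‖t‖ • θ) g : ℝ) * Complex.I) ∂(gam n) =
      charFun (gam n) t := by
    filter_upwards [hs] with θ hθ
    have : charFun (gam n) (‖t‖ • θ) = charFun (gam n) t := by
      rw [ProbabilityTheory.charFun_stdGaussian, ProbabilityTheory.charFun_stdGaussian, norm_smul, hθ]
      simp
    rw [← this, charFun_apply]
    simp only [real_inner_comm]
  rw [integral_congr_ae h2]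
  simp

theorem polar_int (σ : Measure (E n)) [IsProbabilityMeasure σ]
    (hinv : ∀ e : E n ≃ₗᵢ[ℝ] E n, σ.map e = σ) (hs : ∀ᵐ θ ∂σ, ‖θ‖ = 1)
    (F : E n → ℝ) (hF : Measurable F) (hh : ∀ r : ℝ, 0 ≤ r → ∀ x, F (r • x) = r * F x) :
    ∫ x, F x ∂(gam n) = (∫ x, ‖x‖ ∂(gam n)) * ∫ θ, F θ ∂σ := by
  conv_lhs => rw [← polar_law σ hinv hs]
  rw [integral_map (by fun_prop) hF.aestronglyMeasurable]
  simp only [hh _ (norm_nonneg _)]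
  exact integral_prod_mul (fun g : E n => ‖g‖) F

theorem sph_cases (n : ℕ) : sphMeasure n = 0 ∨ (IsProbabilityMeasure (sphMeasure n) ∧
    (∀ e : E n ≃ₗᵢ[ℝ] E n, (sphMeasure n).map e = sphMeasure n) ∧ ∀ᵐ θ ∂(sphMeasure n), ‖θ‖ = 1) := by
  have hm : MeasurableSet (usphere n) := Metric.isClosed_sphere.measurableSet
  by_cases h0 : μH[(n : ℝ) - 1] (usphere n) = 0
  · left
    rw [sphMeasure, Measure.restrict_eq_zero.2 h0, smul_zero]
  by_cases h1 : μH[(n : ℝ) - 1] (usphere n) = ⊤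
  · left
    rw [sphMeasure, h1]; simp
  right
  refine ⟨⟨?_⟩, ?_, ?_⟩
  · rw [sphMeasure, Measure.smul_apply, Measure.restrict_apply_univ, smul_eq_mul, ENNReal.inv_mul_cancel h0 h1]
  · intro e
    rw [sphMeasure, Measure.map_smul]
    congr 1
    have h2 := (e.toIsometryEquiv.measurePreserving_hausdorffMeasure ((n : ℝ) - 1)).restrict_preimage hm
    have h3 : e.toIsometryEquiv ⁻¹' (usphere n) = usphere n := by
      ext x; simp [usphere]
    rw [h3] at h2
    exact h2.map_eq
  · rw [sphMeasure]
    apply Measure.ae_smul_measure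
    filter_upwards [ae_restrict_mem hm] with θ hθ
    simpa [usphere] using hθ

/-- First absolute moment of a standard real Gaussian. -/
def c0 : ℝ := ∫ x, |x| ∂(ProbabilityTheory.gaussianReal 0 1)

theorem c0_pos : 0 < c0 := by
  have hi : Integrable (fun x : ℝ => |x|) (ProbabilityTheory.gaussianReal 0 1) := by
    have := (ProbabilityTheory.memLp_id_gaussianReal (μ := 0) (v := 1) 1)
    simpa using (this.integrable (by simp)).abs
  rw [c0, integral_pos_iff_support_of_nonneg (fun x => abs_nonneg x) hi]
  have h1 : Function.support (fun x : ℝ => |x|) = {0}ᶜ := by ext x; simp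
  have h2 : NoAtoms (ProbabilityTheory.gaussianReal 0 1) := ProbabilityTheory.noAtoms_gaussianReal (by simp)
  rw [h1, prob_compl_eq_one_sub (measurableSet_singleton _)]
  rw [tsub_pos_iff_lt, h2.measure_singleton 0]
  exact one_pos

theorem gam_coord (i : Fin n) : (gam n).map (fun x => x i) = ProbabilityTheory.gaussianReal 0 1 := by
  rw [gam, ← ProbabilityTheory.map_pi_eq_stdGaussian, Measure.map_map (by fun_prop) (by fun_prop)]
  exact (measurePreserving_eval (fun _ : Fin n => ProbabilityTheory.gaussianReal 0 1) i).map_eq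

theorem gam_norm_lower (hn : 0 < n) : c0 * √n ≤ ∫ x, ‖x‖ ∂(gam n) := by
  have h1 : ∀ i : Fin n, ∫ x, |x i| ∂(gam n) = c0 := by
    intro i
    rw [c0, ← gam_coord i, integral_map (by fun_prop) (by fun_prop)]
  have hi : ∀ i : Fin n, Integrable (fun x : E n => |x i|) (gam n) := fun i =>
    gam_integrable_norm.mono (by fun_prop) (ae_of_all _ fun x => by
      simpa using PiLp.norm_apply_le x i)
  have h2 : ∫ x, ∑ i, |x i| ∂(gam n) = n * c0 := by
    rw [integral_finsetSum _ fun i _ => hi i]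
    simp [h1]
  have h3 : ∫ x, ∑ i, |x i| ∂(gam n) ≤ ∫ x, √n * ‖x‖ ∂(gam n) := by
    apply integral_mono (integrable_finsetSum _ fun i _ => hi i) (gam_integrable_norm.const_mul _)
    intro x
    dsimp only
    rw [EuclideanSpace.norm_eq, ← Real.sqrt_mul (by positivity)]
    apply Real.le_sqrt_of_sq_le
    have := sq_sum_le_card_mul_sum_sq (s := Finset.univ) (f := fun i => |x i|)
    simpa using this
  rw [h2, integral_const_mul] at h3
  have h4 : (0 : ℝ) < √n := by positivity
  have h5 : (n : ℝ) = √n * √n := (Real.mul_self_sqrt (by positivity)).symm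
  have : √n * (c0 * √n) ≤ √n * ∫ x, ‖x‖ ∂(gam n) := by
    refine le_trans (le_of_eq ?_) h3
    linear_combination (-c0) * h5
  exact le_of_mul_le_mul_left this h4

theorem gaussianReal_le : ProbabilityTheory.gaussianReal 0 1 ≤ (1 / 2 : ℝ≥0∞) • (volume : Measure ℝ) := by
  rw [ProbabilityTheory.gaussianReal_of_var_ne_zero 0 (by simp), ← withDensity_const]
  apply withDensity_mono
  refine ae_of_all _ fun x => ?_
  have h1 : ProbabilityTheory.gaussianPDFReal 0 1 x ≤ 1 / 2 := by
    rw [ProbabilityTheory.gaussianPDFReal]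
    have h2 : 2 ≤ √(2 * π * ((1 : NNReal) : ℝ)) := by
      apply Real.le_sqrt_of_sq_le
      have := Real.pi_gt_three
      norm_num; linarith
    have h3 : rexp (-(x - 0) ^ 2 / (2 * ((1 : NNReal) : ℝ))) ≤ 1 := by
      rw [Real.exp_le_one_iff]
      apply div_nonpos_of_nonpos_of_nonneg
      · nlinarith [sq_nonneg (x - 0)]
      · positivity
    have h4 : (√(2 * π * ((1 : NNReal) : ℝ)))⁻¹ ≤ 1 / 2 := by
      rw [← one_div]; exact one_div_le_one_div_of_le (by norm_num) h2
    calc _ ≤ (√(2 * π * ((1 : NNReal) : ℝ)))⁻¹ * 1 := by gcongr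
      _ ≤ _ := by simpa using h4
  rw [ProbabilityTheory.gaussianPDF]
  refine (ENNReal.ofReal_le_ofReal h1).trans (le_of_eq ?_)
  rw [ENNReal.ofReal_div_of_pos (by norm_num)]; simp

theorem gam_le_volume (A : Set (E n)) (hA : MeasurableSet A) :
    gam n A ≤ (1 / 2 : ℝ≥0∞) ^ n * volume A := by
  have i1 : SigmaFinite ((1 / 2 : ℝ≥0∞) • (volume : Measure ℝ)) := by
    have : ((1 / 2 : ℝ≥0∞) • (volume : Measure ℝ)) = ((1 / 2 : NNReal) • (volume : Measure ℝ)) := by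
      have h2 : (1 / 2 : ℝ≥0∞) = ((1 / 2 : NNReal) : ℝ≥0∞) := by simp
      rw [h2]; rfl
    rw [this]; infer_instance
  have hpi : Measure.pi (fun _ : Fin n => (1 / 2 : ℝ≥0∞) • (volume : Measure ℝ)) =
      ((1 / 2 : ℝ≥0∞) ^ n) • (volume : Measure (Fin n → ℝ)) := by
    apply Measure.pi_eq
    intro s hs
    simp [Finset.prod_mul_distrib, volume_pi_pi]
  have h1 : ∀ B : Set (Fin n → ℝ), MeasurableSet B →
      Measure.pi (fun _ : Fin n => ProbabilityTheory.gaussianReal 0 1) B ≤ ((1 / 2 : ℝ≥0∞) ^ n) * volume B := by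
    intro B hB
    have h2 : (Measure.pi (fun _ : Fin n => ProbabilityTheory.gaussianReal 0 1)).toOuterMeasure ≤
        OuterMeasure.pi (fun _ : Fin n => ((1 / 2 : ℝ≥0∞) • (volume : Measure ℝ)).toOuterMeasure) := by
      rw [OuterMeasure.le_pi]
      intro s _
      simp only [Measure.coe_toOuterMeasure]
      rw [Measure.pi_pi]
      exact Finset.prod_le_prod' fun i _ => gaussianReal_le (s i)
    have h3 := h2 B
    have h4 : Measure.pi (fun _ : Fin n => (1 / 2 : ℝ≥0∞) • (volume : Measure ℝ)) B =
        OuterMeasure.pi (fun _ : Fin n => ((1 / 2 : ℝ≥0∞) • (volume : Measure ℝ)).toOuterMeasure) B := by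
      rw [Measure.pi_def, toMeasure_apply _ _ hB]
    rw [← h4, hpi] at h3
    simpa using h3
  rw [gam, ← ProbabilityTheory.map_pi_eq_stdGaussian, Measure.map_apply (by fun_prop) hA]
  refine (h1 _ (hA.preimage (by fun_prop))).trans (le_of_eq ?_)
  congr 1
  exact (PiLp.volume_preserving_toLp (Fin n)).measure_preimage hA.nullMeasurableSet

theorem gam_ac : gam n ≪ (volume : Measure (E n)) := by
  refine Measure.AbsolutelyContinuous.mk fun s hs h0 => ?_
  have := gam_le_volume s hs
  rw [h0, mul_zero] at this
  exact le_antisymm this zero_le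

theorem gam_small (hn : 0 < n) (A : Set (E n)) (hA : MeasurableSet A) (h1 : volume A = 1) :
    (gam n).real A ≤ 1 / 2 := by
  have h2 := gam_le_volume A hA
  rw [h1, mul_one] at h2
  have h3 : (1 / 2 : ℝ≥0∞) ^ n ≤ (1 / 2 : ℝ≥0∞) ^ 1 :=
    pow_le_pow_of_le_one zero_le (by simp) hn
  have h4 := ENNReal.toReal_mono (by simp) (h2.trans h3)
  simpa [Measure.real] using h4


/-! ### Gradients of seminorms and first variation -/

theorem sem_lip (q : Seminorm ℝ (E n)) (C : ℝ) (hC : ∀ x, q x ≤ C * ‖x‖) :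
    LipschitzWith (Real.nnabs C) q := by
  refine LipschitzWith.of_dist_le_mul fun x y => ?_
  rw [Real.dist_eq, dist_eq_norm]
  refine (abs_sub_map_le_sub q x y).trans ((hC _).trans ?_)
  gcongr
  exact le_abs_self C

theorem sem_deriv_le (q : Seminorm ℝ (E n)) (u z : E n) (L : E n →L[ℝ] ℝ) (h : HasFDerivAt q L u) :
    L z ≤ q z := by
  have h1 : HasDerivAt (fun t : ℝ => u + t • z) z 0 := by
    simpa using ((hasDerivAt_id (0 : ℝ)).smul_const z).const_add u
  have h2 : HasDerivAt (fun t : ℝ => q (u + t • z)) (L z) 0 := by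
    have h3 : HasFDerivAt q L (u + (0 : ℝ) • z) := by simpa using h
    exact h3.comp_hasDerivAt 0 h1
  have h4 := h2.le_of_lip' (C := q z) (apply_nonneg q z) (Filter.Eventually.of_forall fun t => by
    have := abs_sub_map_le_sub q (u + t • z) (u + (0 : ℝ) • z)
    rw [Real.norm_eq_abs, Real.norm_eq_abs]
    refine this.trans (le_of_eq ?_)
    rw [show u + t • z - (u + (0 : ℝ) • z) = t • z by simp, map_smul_eq_mul, Real.norm_eq_abs]
    simp [mul_comm])
  exact (le_abs_self _).trans h4

theorem sem_euler (q : Seminorm ℝ (E n)) (u : E n) (L : E n →L[ℝ] ℝ) (h : HasFDerivAt q L u) :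
    L u = q u := by
  have h1 : HasDerivAt (fun t : ℝ => u + t • u) u 0 := by
    simpa using ((hasDerivAt_id (0 : ℝ)).smul_const u).const_add u
  have h2 : HasDerivAt (fun t : ℝ => q (u + t • u)) (L u) 0 := by
    have h3 : HasFDerivAt q L (u + (0 : ℝ) • u) := by simpa using h
    exact h3.comp_hasDerivAt 0 h1
  have h3 : HasDerivAt (fun t : ℝ => (1 + t) * q u) (q u) 0 := by
    simpa using ((hasDerivAt_id (0 : ℝ)).const_add 1).mul_const (q u)
  refine h2.unique (h3.congr_of_eventuallyEq ?_)
  filter_upwards [lt_mem_nhds (show (-1 : ℝ) < 0 by norm_num)] with t ht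
  rw [show u + t • u = (1 + t) • u by rw [add_smul, one_smul], map_smul_eq_mul, Real.norm_eq_abs,
    abs_of_pos (by linarith)]

theorem grad_exists (q : Seminorm ℝ (E n)) (C : ℝ) (hC : ∀ x, q x ≤ C * ‖x‖) :
    ∃ Y : E n → E n, Measurable Y ∧ (∀ u z, ⟪Y u, z⟫ ≤ q z) ∧
      ∀ᵐ u ∂(gam n), HasFDerivAt q (innerSL ℝ (Y u)) u := by
  have he : ∀ u, innerSL ℝ ((InnerProductSpace.toDual ℝ (E n)).symm (fderiv ℝ q u)) = fderiv ℝ q u := by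
    intro u
    ext z
    simp
  refine ⟨fun u => (InnerProductSpace.toDual ℝ (E n)).symm (fderiv ℝ q u), ?_, ?_, ?_⟩
  · exact (LinearIsometryEquiv.continuous _).measurable.comp (measurable_fderiv ℝ q)
  · intro u z
    rw [InnerProductSpace.toDual_symm_apply]
    by_cases h : DifferentiableAt ℝ q u
    · exact sem_deriv_le q u z _ h.hasFDerivAt
    · rw [fderiv_zero_of_not_differentiableAt h]; simp
  · have h1 : ∀ᵐ u ∂(volume : Measure (E n)), DifferentiableAt ℝ q u :=
      (sem_lip q C hC).ae_differentiableAt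
    filter_upwards [gam_ac.ae_le h1] with u hu
    rw [he]; exact hu.hasFDerivAt

/-- standard basis -/
abbrev sb (n : ℕ) : Module.Basis (Fin n) ℝ (E n) := (EuclideanSpace.basisFun (Fin n) ℝ).toBasis

theorem det_deriv (M : Matrix (Fin n) (Fin n) ℝ) :
    HasDerivAt (fun t : ℝ => (1 + t • M).det) M.trace 0 := by
  set P := (1 + (Polynomial.X : Polynomial ℝ) • M.map Polynomial.C).det with hP
  have h1 : ∀ t : ℝ, (1 + t • M).det = P.eval t := by
    intro t
    rw [hP, ← Polynomial.coe_evalRingHom, RingHom.map_det]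
    congr 1
    ext i j
    by_cases hij : i = j <;> simp [hij, Matrix.one_apply] <;> exact mul_comm _ _
  simp only [h1]
  have h2 := P.hasDerivAt 0
  rw [hP, Matrix.derivative_det_one_add_X_smul] at h2
  exact h2

theorem first_variation (hn : 0 < n) (q : Seminorm ℝ (E n)) (C : ℝ) (hC : ∀ x, q x ≤ C * ‖x‖)
    (X : E n → E n) (hXm : Measurable X)
    (hX : ∀ᵐ u ∂(gam n), HasFDerivAt q (innerSL ℝ (X u)) u)
    (hmin : ∀ T : E n →ₗ[ℝ] E n, |LinearMap.det T| = 1 → ∫ u, q u ∂(gam n) ≤ ∫ u, q (T u) ∂(gam n))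
    (M : Matrix (Fin n) (Fin n) ℝ) :
    ∫ u, ⟪X u, Matrix.toLin (sb n) (sb n) M u⟫ ∂(gam n) = M.trace / n * ∫ u, q u ∂(gam n) := by
  set B := Matrix.toLin (sb n) (sb n) M with hB
  have hqc : Continuous q := (sem_lip q C hC).continuous
  have hBc : Continuous B := B.continuous_of_finiteDimensional
  set b := ‖LinearMap.toContinuousLinearMap B‖ with hb
  have hBb : ∀ u, ‖B u‖ ≤ b * ‖u‖ := fun u => (LinearMap.toContinuousLinearMap B).le_opNorm u
  have hφ : HasDerivAt (fun t : ℝ => ∫ u, q (u + t • B u) ∂(gam n)) (∫ u, ⟪X u, B u⟫ ∂(gam n)) 0 := by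
    refine (hasDerivAt_integral_of_dominated_loc_of_lip (s := Set.univ) (bound := fun u => |C| * b * ‖u‖) (by simp) ?_ ?_ ?_ ?_ ?_ ?_).2
    · refine Filter.Eventually.of_forall fun t => ?_
      exact (hqc.comp (continuous_id.add (hBc.const_smul t))).aestronglyMeasurable
    · simp only [zero_smul, add_zero]
      exact gam_integrable_lin hqc.aestronglyMeasurable C fun x => by
        rw [abs_of_nonneg (apply_nonneg q x)]; exact hC x
    · exact (hXm.inner hBc.measurable).aestronglyMeasurable
    · refine ae_of_all _ fun u => LipschitzOnWith.of_dist_le_mul fun s _ t _ => ?_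
      rw [Real.dist_eq, Real.dist_eq, Real.coe_nnabs]
      refine (abs_sub_map_le_sub q _ _).trans ((hC _).trans ?_)
      rw [show u + s • B u - (u + t • B u) = (s - t) • B u by rw [sub_smul]; abel, norm_smul, Real.norm_eq_abs]
      have hb0 : 0 ≤ b := norm_nonneg _
      rw [abs_of_nonneg (by positivity : 0 ≤ |C| * b * ‖u‖)]
      calc C * (|s - t| * ‖B u‖) ≤ |C| * (|s - t| * (b * ‖u‖)) := by
            gcongr
            · exact le_abs_self C
            · exact hBb u
        _ = _ := by ring
    · exact gam_integrable_norm.const_mul _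
    · filter_upwards [hX] with u hu
      have h1 : HasDerivAt (fun t : ℝ => u + t • B u) (B u) 0 := by
        simpa using ((hasDerivAt_id (0 : ℝ)).smul_const (B u)).const_add u
      have h3 : HasFDerivAt q (innerSL ℝ (X u)) (u + (0 : ℝ) • B u) := by simpa using hu
      have h4 := h3.comp_hasDerivAt 0 h1
      exact h4
  set I := ∫ u, q u ∂(gam n) with hI
  have hD := det_deriv M
  have hD0 : (1 + (0 : ℝ) • M).det = 1 := by simp
  have hDr : HasDerivAt (fun t : ℝ => (1 + t • M).det ^ (1 / (n : ℝ)) * I) (M.trace / n * I) 0 := by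
    have := (hD.rpow_const (p := 1 / (n : ℝ)) (Or.inl (by rw [hD0]; norm_num))).mul_const I
    rw [hD0] at this
    rw [Real.one_rpow, mul_one, mul_one_div] at this
    exact this
  have hpos : ∀ᶠ t : ℝ in nhds 0, 0 < (1 + t • M).det := by
    have := hD.continuousAt.tendsto
    rw [hD0] at this
    exact this.eventually (lt_mem_nhds one_pos)
  have hloc : IsLocalMin (fun t : ℝ => (∫ u, q (u + t • B u) ∂(gam n)) - (1 + t • M).det ^ (1 / (n : ℝ)) * I) 0 := by
    filter_upwards [hpos] with t ht
    have h0 : (∫ u, q (u + (0 : ℝ) • B u) ∂(gam n)) - (1 + (0 : ℝ) • M).det ^ (1 / (n : ℝ)) * I = 0 := by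
      rw [hD0]; simp [hI]
    rw [h0]
    set D := (1 + t • M).det with hDdef
    have hr : 0 < D ^ (1 / (n : ℝ)) := Real.rpow_pos_of_pos ht _
    set T : E n →ₗ[ℝ] E n := (D ^ (1 / (n : ℝ)))⁻¹ • (LinearMap.id + t • B) with hT
    have hTd : |LinearMap.det T| = 1 := by
      have h1 : LinearMap.id + t • B = Matrix.toLin (sb n) (sb n) (1 + t • M) := by
        rw [hB, map_add, Matrix.toLin_one, map_smul]
      rw [hT, LinearMap.det_smul, h1, LinearMap.det_toLin, ← hDdef, finrank_euclideanSpace_fin, inv_pow,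
        ← Real.rpow_natCast, ← Real.rpow_mul ht.le, one_div_mul_cancel (by positivity), Real.rpow_one,
        inv_mul_cancel₀ ht.ne', abs_one]
    have h2 := hmin T hTd
    have h3 : ∀ u, q (T u) = (D ^ (1 / (n : ℝ)))⁻¹ * q (u + t • B u) := by
      intro u
      rw [hT]
      simp only [LinearMap.smul_apply, LinearMap.add_apply, LinearMap.id_apply]
      rw [map_smul_eq_mul, Real.norm_eq_abs, abs_of_pos (inv_pos.2 hr)]
    simp only [h3] at h2
    rw [integral_const_mul, inv_mul_eq_div, le_div_iff₀ hr] at h2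
    linarith
  have := hloc.hasDerivAt_eq_zero (hφ.sub hDr)
  linarith


/-! ### Convex bodies -/

theorem body_nhds {K : Set (E n)} (hK : IsConvexBody K) : K ∈ nhds (0 : E n) := by
  obtain ⟨h1, h2, ⟨x, hx⟩, h4⟩ := hK
  have hx' : -x ∈ interior K := by
    have h5 : interior K = -interior K := by
      conv_lhs => rw [h4]
      exact ((Homeomorph.neg (E n)).preimage_interior K).symm
    rw [h5]; simpa using hx
  have h0 : (0 : E n) ∈ interior K := by
    have := h2.interior.midpoint_mem hx hx'
    rwa [midpoint_self_neg] at this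
  exact mem_interior_iff_mem_nhds.1 h0

theorem body_neg {K : Set (E n)} (hK : IsConvexBody K) {x : E n} (hx : x ∈ K) : -x ∈ K := by
  have h4 := hK.2.2.2
  rw [h4]; simpa using hx

theorem body_gauge {K : Set (E n)} (hK : IsConvexBody K) :
    ∃ q : Seminorm ℝ (E n), (∀ x, q x = gauge K x) ∧ ∃ C, ∀ x, q x ≤ C * ‖x‖ := by
  have ha : Absorbent ℝ K := absorbent_nhds_zero (body_nhds hK)
  have hs : ∀ x ∈ K, -x ∈ K := fun x hx => body_neg hK hx
  refine ⟨Seminorm.of (gauge K) (gauge_add_le hK.2.1 ha) ?_, fun x => rfl, ?_⟩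
  · intro a x
    rcases le_total 0 a with h | h
    · rw [gauge_smul_of_nonneg h, Real.norm_eq_abs, abs_of_nonneg h]; rfl
    · rw [← gauge_neg hs, ← neg_smul, gauge_smul_of_nonneg (neg_nonneg.2 h), Real.norm_eq_abs, abs_of_nonpos h]; rfl
  · obtain ⟨r, hr, hrK⟩ := Metric.mem_nhds_iff.1 (body_nhds hK)
    refine ⟨1 / r, fun x => ?_⟩
    have := mul_gauge_le_norm hrK (x := x)
    change gauge K x ≤ _
    rw [one_div_mul_eq_div, le_div_iff₀ hr]; linarith

theorem body_gauge_le_one {K : Set (E n)} (hK : IsConvexBody K) (x : E n) : gauge K x ≤ 1 ↔ x ∈ K := by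
  rw [gauge_le_one_iff_mem_closure hK.2.1 (body_nhds hK), hK.1.isClosed.closure_eq]

theorem body_bdd {K : Set (E n)} (hK : IsConvexBody K) (y : E n) :
    BddAbove ((fun x : E n => ⟪x, y⟫) '' K) :=
  (hK.1.image (by fun_prop)).bddAbove

theorem body_le_dual {K : Set (E n)} (hK : IsConvexBody K) {x : E n} (hx : x ∈ K) (y : E n) :
    ⟪x, y⟫ ≤ dualGauge K y :=
  le_csSup (body_bdd hK y) ⟨x, hx, rfl⟩

theorem body_dual_le {K : Set (E n)} (hK : IsConvexBody K) (y : E n) (r : ℝ)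
    (h : ∀ x ∈ K, ⟪x, y⟫ ≤ r) : dualGauge K y ≤ r := by
  apply csSup_le
  · exact Set.Nonempty.image _ ⟨0, mem_of_mem_nhds (body_nhds hK)⟩
  · rintro _ ⟨x, hx, rfl⟩; exact h x hx

theorem body_dual {K : Set (E n)} (hK : IsConvexBody K) :
    ∃ q : Seminorm ℝ (E n), (∀ x, q x = dualGauge K x) ∧ ∃ C, ∀ x, q x ≤ C * ‖x‖ := by
  have hle : ∀ (a : ℝ) (x : E n), dualGauge K (a • x) ≤ |a| * dualGauge K x := by
    intro a x
    refine body_dual_le hK _ _ fun z hz => ?_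
    rw [inner_smul_right]
    rcases le_total 0 a with h | h
    · rw [abs_of_nonneg h]
      exact mul_le_mul_of_nonneg_left (body_le_dual hK hz x) h
    · rw [abs_of_nonpos h]
      have := mul_le_mul_of_nonneg_left (body_le_dual hK (body_neg hK hz) x) (neg_nonneg.2 h)
      simpa using this
  refine ⟨Seminorm.of (dualGauge K) ?_ ?_, fun x => rfl, ?_⟩
  · intro x y
    refine body_dual_le hK _ _ fun z hz => ?_
    rw [inner_add_right]
    exact add_le_add (body_le_dual hK hz x) (body_le_dual hK hz y)
  · intro a x
    rw [Real.norm_eq_abs]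
    refine le_antisymm (hle a x) ?_
    rcases eq_or_ne a 0 with rfl | ha
    · have := body_le_dual hK (mem_of_mem_nhds (body_nhds hK)) ((0 : ℝ) • x)
      simpa using this
    · have := hle a⁻¹ (a • x)
      rw [smul_smul, inv_mul_cancel₀ ha, one_smul, abs_inv] at this
      rwa [inv_mul_eq_div, le_div_iff₀' (abs_pos.2 ha)] at this
  · obtain ⟨R, hR⟩ := hK.1.isBounded.exists_norm_le
    refine ⟨R, fun y => body_dual_le hK _ _ fun x hx => ?_⟩
    exact (real_inner_le_norm x y).trans (by gcongr; exact hR x hx)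

theorem body_bipolar {K : Set (E n)} (hK : IsConvexBody K) (x : E n)
    (h : ∀ z, ⟪x, z⟫ ≤ dualGauge K z) : x ∈ K := by
  by_contra hx
  obtain ⟨f, u, h1, h2⟩ := geometric_hahn_banach_closed_point hK.2.1 hK.1.isClosed hx
  set w := (InnerProductSpace.toDual ℝ (E n)).symm f with hw
  have hf : ∀ z, f z = ⟪z, w⟫ := by
    intro z; rw [real_inner_comm, hw, InnerProductSpace.toDual_symm_apply]
  have h3 : dualGauge K w ≤ u := body_dual_le hK _ _ fun z hz => by
    rw [← hf]; exact (h1 z hz).le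
  have h4 := h w
  rw [← hf] at h4
  linarith

theorem dual_image (K : Set (E n)) (T : E n →ₗ[ℝ] E n) (y : E n) :
    dualGauge (T '' K) y = dualGauge K (LinearMap.adjoint T y) := by
  rw [dualGauge, dualGauge, Set.image_image]
  simp only [LinearMap.adjoint_inner_right]

theorem body_hmin {K : Set (E n)} (hK : IsConvexBody K) (hp : IsProbabilityMeasure (sphMeasure n))
    (hinv : ∀ e : E n ≃ₗᵢ[ℝ] E n, (sphMeasure n).map e = sphMeasure n)
    (hs : ∀ᵐ θ ∂(sphMeasure n), ‖θ‖ = 1) (hmin : IsMinMeanWidth K) (T : E n →ₗ[ℝ] E n)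
    (hT : |LinearMap.det T| = 1) :
    ∫ u, dualGauge K u ∂(gam n) ≤ ∫ u, dualGauge K (T u) ∂(gam n) := by
  obtain ⟨q, hq, C, hC⟩ := body_dual hK
  have hqc := (sem_lip q C hC).continuous
  have hTc : Continuous T := T.continuous_of_finiteDimensional
  have hm := hmin (LinearMap.adjoint T) (by
    rw [← LinearMap.det_toMatrix (sb n), LinearMap.toMatrix_adjoint, Matrix.det_conjTranspose]
    rw [LinearMap.det_toMatrix]; simpa using hT)
  rw [Mstar, Mstar] at hm
  simp only [dual_image, LinearMap.adjoint_adjoint] at hm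
  simp only [← hq] at hm ⊢
  have e1 := polar_int _ hinv hs (fun u => q u) hqc.measurable (fun r hr x => by
    rw [map_smul_eq_mul, Real.norm_eq_abs, abs_of_nonneg hr])
  have e2 := polar_int _ hinv hs (fun u => q (T u)) (hqc.comp hTc).measurable (fun r hr x => by
    rw [map_smul, map_smul_eq_mul, Real.norm_eq_abs, abs_of_nonneg hr])
  rw [e1, e2]
  exact mul_le_mul_of_nonneg_left hm (integral_nonneg fun x => norm_nonneg x)


/-! ### Auerbach bases and the expansion of the correlation function -/

theorem auerbach {K : Set (E n)} (hK : IsConvexBody K) :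
    ∃ v w : Fin n → E n, (∀ i, v i ∈ K) ∧ (∀ i, ∀ x ∈ K, |⟪w i, x⟫| ≤ 1) ∧
      ∀ x, x = ∑ i, ⟪w i, x⟫ • v i := by
  classical
  have hcpt : IsCompact (Set.pi Set.univ fun _ : Fin n => K) := isCompact_univ_pi fun _ => hK.1
  have h0 : (0 : E n) ∈ K := mem_of_mem_nhds (body_nhds hK)
  have hdc : Continuous fun v : Fin n → E n => |(sb n).det v| := by
    have : Continuous fun v : Fin n → E n => (sb n).det v := by
      simp only [Module.Basis.det_apply]
      apply Continuous.matrix_det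
      refine continuous_matrix fun i j => ?_
      simp only [Module.Basis.toMatrix_apply]
      have : Continuous fun x : E n => (sb n).repr x i := by
        simp only [sb, OrthonormalBasis.coe_toBasis_repr_apply, EuclideanSpace.basisFun_repr]
        fun_prop
      exact this.comp (continuous_apply j)
    exact this.abs
  obtain ⟨v, hvK, hv⟩ := hcpt.exists_isMaxOn ⟨fun _ => 0, fun _ _ => h0⟩ hdc.continuousOn
  have hvK' : ∀ i, v i ∈ K := fun i => hvK i (Set.mem_univ _)
  have hmax : ∀ v' : Fin n → E n, (∀ i, v' i ∈ K) → |(sb n).det v'| ≤ |(sb n).det v| := fun v' h' =>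
    hv (fun i _ => h' i)
  obtain ⟨r, hr, hrK⟩ := Metric.nhds_basis_closedBall.mem_iff.1 (body_nhds hK)
  have hpos : 0 < |(sb n).det v| := by
    refine lt_of_lt_of_le ?_ (hmax (fun i => r • sb n i) fun i => hrK ?_)
    · have h1 : (fun i => r • sb n i) = fun i => ((fun _ : Fin n => r) i) • (sb n i) := rfl
      rw [h1, AlternatingMap.map_smul_univ, Module.Basis.det_self]
      rw [abs_pos, smul_eq_mul, mul_one]
      exact Finset.prod_ne_zero_iff.2 fun _ _ => hr.ne'
    · simp [norm_smul, abs_of_pos hr]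
  have hne : (sb n).det v ≠ 0 := abs_pos.1 hpos
  have hb := (Module.Basis.is_basis_iff_det (sb n) (v := v)).2 (isUnit_iff_ne_zero.2 hne)
  set b := Module.Basis.mk hb.1 hb.2.ge with hbdef
  have hbv : ∀ i, b i = v i := fun i => by rw [hbdef, Module.Basis.mk_apply]
  have hcoord : ∀ i x, (sb n).det (Function.update v i x) = b.repr x i * (sb n).det v := by
    intro i x
    have h1 := b.sum_repr x
    conv_lhs => rw [← h1]
    rw [AlternatingMap.map_update_sum]
    rw [Finset.sum_eq_single i]
    · rw [AlternatingMap.map_update_smul, hbv, Function.update_eq_self]; rfl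
    · intro j _ hj
      rw [AlternatingMap.map_update_smul, hbv, AlternatingMap.map_update_self _ _ hj.symm, smul_zero]
    · simp
  refine ⟨v, fun i => (InnerProductSpace.toDual ℝ (E n)).symm (LinearMap.toContinuousLinearMap (b.coord i)),
    hvK', ?_, ?_⟩
  · intro i x hx
    rw [InnerProductSpace.toDual_symm_apply, LinearMap.coe_toContinuousLinearMap', Module.Basis.coord_apply]
    have h1 := hmax (Function.update v i x) (fun j => by
      rcases eq_or_ne j i with rfl | hj
      · simpa using hx
      · simpa [hj] using hvK' j)
    rw [hcoord, abs_mul] at h1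
    nlinarith
  · intro x
    conv_lhs => rw [← b.sum_repr x]
    refine Finset.sum_congr rfl fun i _ => ?_
    rw [InnerProductSpace.toDual_symm_apply, LinearMap.coe_toContinuousLinearMap', Module.Basis.coord_apply, hbv]

/-- vector first moments -/
def vmom (X : E n → E n) (j : Fin n) : E n := ∫ u, u j • X u ∂(gam n)

theorem bdd_coord_integrable (X : E n → E n) (hX : Measurable X) (B : ℝ) (hB : ∀ u, ‖X u‖ ≤ B) (j : Fin n) :
    Integrable (fun u => u j • X u) (gam n) := by
  have h0 : Integrable (fun u : E n => u j) (gam n) := gam_integrable_norm.mono (by fun_prop)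
    (ae_of_all _ fun x => by simpa using PiLp.norm_apply_le x j)
  exact h0.smul_bdd B hX.aestronglyMeasurable (ae_of_all _ hB)

theorem vmom_inner (X : E n → E n) (hX : Measurable X) (B : ℝ) (hB : ∀ u, ‖X u‖ ≤ B) (j : Fin n) (w : E n) :
    ⟪w, vmom X j⟫ = ∫ u, ⟪w, X u⟫ * u j ∂(gam n) := by
  rw [vmom, ← integral_inner (bdd_coord_integrable X hX B hB j)]
  simp only [inner_smul_right, mul_comm]

theorem A1_identity (hn : 0 < n) (h q : Seminorm ℝ (E n)) (C : ℝ) (hC : ∀ x, h x ≤ C * ‖x‖)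
    (X Y : E n → E n) (hXm : Measurable X) (hYm : Measurable Y) (B : ℝ) (hXB : ∀ u, ‖X u‖ ≤ B)
    (hYB : ∀ u, ‖Y u‖ ≤ B)
    (hX : ∀ᵐ u ∂(gam n), HasFDerivAt h (innerSL ℝ (X u)) u)
    (hY : ∀ᵐ u ∂(gam n), HasFDerivAt q (innerSL ℝ (Y u)) u)
    (hmin : ∀ T : E n →ₗ[ℝ] E n, |LinearMap.det T| = 1 → ∫ u, h u ∂(gam n) ≤ ∫ u, h (T u) ∂(gam n)) :
    ∑ j, ⟪vmom X j, vmom Y j⟫ = (∫ u, q u ∂(gam n)) / n * ∫ u, h u ∂(gam n) := by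
  set M : Matrix (Fin n) (Fin n) ℝ := Matrix.of fun i j => vmom Y j i with hM
  have hv := first_variation hn h C hC X hXm hX hmin M
  have hi : ∀ (Z : E n → E n), Measurable Z → (∀ u, ‖Z u‖ ≤ B) → ∀ i j,
      Integrable (fun u => Z u i * u j) (gam n) := by
    intro Z hZ hZB i j
    have := (bdd_coord_integrable Z hZ B hZB j).const_inner (𝕜 := ℝ) (EuclideanSpace.single i 1)
    refine this.congr (ae_of_all _ fun u => ?_)
    dsimp only
    rw [inner_smul_right, EuclideanSpace.inner_single_left]
    simp [mul_comm]
  have hc : ∀ (Z : E n → E n), Measurable Z → (∀ u, ‖Z u‖ ≤ B) → ∀ i j,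
      vmom Z j i = ∫ u, Z u i * u j ∂(gam n) := by
    intro Z hZ hZB i j
    have := vmom_inner Z hZ B hZB j (EuclideanSpace.single i 1)
    simp only [EuclideanSpace.inner_single_left] at this
    simpa using this
  have htr : M.trace = ∫ u, q u ∂(gam n) := by
    rw [Matrix.trace]
    simp only [Matrix.diag_apply, hM, Matrix.of_apply, hc Y hYm hYB]
    rw [← integral_finsetSum _ fun i _ => hi Y hYm hYB i i]
    apply integral_congr_ae
    filter_upwards [hY] with u hu
    rw [← sem_euler q u _ hu]
    simp [PiLp.inner_apply, mul_comm]
  rw [htr] at hv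
  rw [← hv]
  have h1 : ∀ u, ⟪X u, Matrix.toLin (sb n) (sb n) M u⟫ = ∑ i, ∑ j, M i j * (X u i * u j) := by
    intro u
    rw [PiLp.inner_apply]
    refine Finset.sum_congr rfl fun i _ => ?_
    have h2 : (Matrix.toLin (sb n) (sb n) M u) i = ∑ j, M i j * u j := by
      have h3 := Matrix.toLin_apply (sb n) (sb n) M u
      rw [h3]
      simp [Matrix.mulVec, dotProduct, Finset.sum_apply, Pi.single_apply]
    rw [h2]
    simp only [RCLike.inner_apply, RCLike.conj_to_real, Finset.sum_mul, Finset.mul_sum]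
    refine Finset.sum_congr rfl fun j _ => ?_
    ring
  have h4 : ∫ u, ⟪X u, Matrix.toLin (sb n) (sb n) M u⟫ ∂(gam n) = ∑ i, ∑ j, M i j * vmom X j i := by
    rw [integral_congr_ae (ae_of_all _ h1)]
    refine (integral_finsetSum _ fun i _ => integrable_finsetSum _ fun j _ =>
      (hi X hXm hXB i j).const_mul _).trans (Finset.sum_congr rfl fun i _ => ?_)
    refine (integral_finsetSum _ fun j _ => (hi X hXm hXB _ j).const_mul _).trans
      (Finset.sum_congr rfl fun j _ => ?_)
    rw [hc X hXm hXB]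
    exact integral_const_mul _ _
  rw [h4, Finset.sum_comm]
  refine Finset.sum_congr rfl fun j _ => ?_
  rw [PiLp.inner_apply]
  refine Finset.sum_congr rfl fun i _ => ?_
  simp [hM, mul_comm]

theorem psi_expansion {K : Set (E n)} (hK : IsConvexBody K) (X Y : E n → E n) (hXm : Measurable X)
    (hYm : Measurable Y) (B : ℝ) (hXB : ∀ u, ‖X u‖ ≤ B) (hYB : ∀ u, ‖Y u‖ ≤ B)
    (hX : ∀ u, X u ∈ K) (hY : ∀ u, ∀ z ∈ K, |⟪Y u, z⟫| ≤ 1) :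
    ∃ A : ℕ → ℂ, Summable (fun k => ‖A k‖) ∧ ∑' k, ‖A k‖ ≤ n ∧
      A 1 = ((∑ j, ⟪vmom X j, vmom Y j⟫ : ℝ) : ℂ) ∧
      ∀ s c : ℝ, s ^ 2 + c ^ 2 = 1 → |s| < 1 →
        ((∫ p : E n × E n, ⟪X (s • p.1 + c • p.2), Y p.1⟫ ∂((gam n).prod (gam n)) : ℝ) : ℂ) =
          ∑' k, A k * (s : ℂ) ^ k := by
  obtain ⟨v, w, hv, hw, hvw⟩ := auerbach hK
  have hf : ∀ i, Measurable fun u => ⟪w i, X u⟫ := fun i => measurable_const.inner hXm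
  have hg : ∀ i, Measurable fun u => ⟪Y u, v i⟫ := fun i => hYm.inner measurable_const
  have hex : ∀ a b : E n, ⟪a, b⟫ = ∑ i, ⟪w i, a⟫ * ⟪b, v i⟫ := by
    intro a b
    conv_lhs => rw [hvw a]
    rw [sum_inner]
    simp only [inner_smul_left, RCLike.conj_to_real, real_inner_comm]
  choose A hA1 hA2 hA3 hA4 using fun i => mehler (fun u => ⟪w i, X u⟫) (fun u => ⟪Y u, v i⟫) (hf i) (hg i)
    (fun u => hw i _ (hX u)) (fun u => hY u _ (hv i))
  have hsm : Summable fun k => ∑ i, ‖A i k‖ := summable_sum fun i _ => hA1 i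
  have hle : ∀ k, ‖∑ i, A i k‖ ≤ ∑ i, ‖A i k‖ := fun k => norm_sum_le _ _
  refine ⟨fun k => ∑ i, A i k, ?_, ?_, ?_, ?_⟩
  · exact Summable.of_nonneg_of_le (fun _ => norm_nonneg _) hle hsm
  · refine ((Summable.of_nonneg_of_le (fun _ => norm_nonneg _) hle hsm).tsum_le_tsum hle hsm).trans ?_
    rw [Summable.tsum_finsetSum fun i _ => hA1 i]
    refine (Finset.sum_le_sum fun i _ => hA2 i).trans ?_
    simp
  · simp only [hA3]
    rw [← Complex.ofReal_sum, Finset.sum_comm]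
    congr 1
    refine Finset.sum_congr rfl fun j _ => ?_
    rw [hex]
    refine Finset.sum_congr rfl fun i _ => ?_
    rw [vmom_inner X hXm B hXB, real_inner_comm (v i), vmom_inner Y hYm B hYB]
    simp only [real_inner_comm]
  · intro s c hsc hs
    have hIntg : ∀ i, Integrable (fun p : E n × E n => ⟪w i, X (s • p.1 + c • p.2)⟫ * ⟪Y p.1, v i⟫)
        ((gam n).prod (gam n)) := by
      intro i
      refine bdd_integrable ?_ 1 fun p => ?_
      · apply Measurable.aestronglyMeasurable
        exact ((hf i).comp (by fun_prop)).mul ((hg i).comp measurable_fst)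
      · rw [norm_mul]
        exact mul_le_one₀ (hw i _ (hX _)) (norm_nonneg _) (hY _ _ (hv i))
    simp only [hex (X _) (Y _)]
    rw [integral_finsetSum _ fun i _ => hIntg i, Complex.ofReal_sum]
    simp only [Finset.sum_mul]
    have hs2 : ∀ i, Summable fun k => A i k * (s : ℂ) ^ k := fun i => by
      refine Summable.of_norm_bounded (hA1 i) fun k => ?_
      rw [norm_mul, norm_pow, Complex.norm_real, Real.norm_eq_abs]
      exact mul_le_of_le_one_right (norm_nonneg _) (pow_le_one₀ (abs_nonneg _) hs.le)
    rw [Summable.tsum_finsetSum fun i _ => hs2 i]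
    exact Finset.sum_congr rfl fun i _ => hA4 i s c hsc hs


/-! ### The Ornstein-Uhlenbeck semigroup on bounded measurable functions -/

theorem cs_int {Ω : Type*} [MeasurableSpace Ω] (μ : Measure Ω) (a b : Ω → ℝ)
    (ha : Integrable (fun x => a x ^ 2) μ) (hb : Integrable (fun x => b x ^ 2) μ)
    (hab : Integrable (fun x => a x * b x) μ) :
    ∫ x, a x * b x ∂μ ≤ √(∫ x, a x ^ 2 ∂μ) * √(∫ x, b x ^ 2 ∂μ) := by
  set P := ∫ x, a x ^ 2 ∂μ with hP
  set Q := ∫ x, b x ^ 2 ∂μ with hQ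
  set R := ∫ x, a x * b x ∂μ with hR
  have h1 : ∀ t : ℝ, 0 ≤ P * (t * t) + (2 * R) * t + Q := by
    intro t
    have h2 : 0 ≤ ∫ x, (t ^ 2 * a x ^ 2 + 2 * t * (a x * b x)) + b x ^ 2 ∂μ := by
      apply integral_nonneg
      intro x
      show 0 ≤ (t ^ 2 * a x ^ 2 + 2 * t * (a x * b x)) + b x ^ 2
      nlinarith [sq_nonneg (t * a x + b x)]
    have i12 : Integrable (fun x => t ^ 2 * a x ^ 2 + 2 * t * (a x * b x)) μ :=
      (ha.const_mul _).add (hab.const_mul _)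
    rw [integral_add i12 hb,
      integral_add (ha.const_mul _) (hab.const_mul _), integral_const_mul, integral_const_mul] at h2
    linarith
  have h3 := discrim_le_zero h1
  rw [discrim] at h3
  have hP0 : 0 ≤ P := integral_nonneg fun x => sq_nonneg _
  rw [← Real.sqrt_mul hP0]
  apply Real.le_sqrt_of_sq_le
  linarith

/-- bounded measurable vector fields -/
def Vb (n : ℕ) : Submodule ℝ (E n → E n) where
  carrier := {f | Measurable f ∧ ∃ B : ℝ, ∀ u, ‖f u‖ ≤ B}
  add_mem' := by
    rintro f g ⟨hf, B, hB⟩ ⟨hg, B', hB'⟩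
    exact ⟨hf.add hg, B + B', fun u => (norm_add_le _ _).trans (add_le_add (hB u) (hB' u))⟩
  zero_mem' := ⟨measurable_const, 0, fun u => by simp⟩
  smul_mem' := by
    rintro a f ⟨hf, B, hB⟩
    refine ⟨hf.const_smul a, |a| * B, fun u => ?_⟩
    rw [Pi.smul_apply, norm_smul, Real.norm_eq_abs]
    exact mul_le_mul_of_nonneg_left (hB u) (abs_nonneg a)

theorem vb_int_q {Ω : Type*} [MeasurableSpace Ω] (μ : Measure Ω) [IsFiniteMeasure μ] (G : E n → ℝ)
    (hG : Continuous G) (F : Ω → E n) (hF : Measurable F) (B : ℝ) (hB : ∀ x, ‖F x‖ ≤ B) :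
    Integrable (fun x => G (F x)) μ := by
  obtain ⟨D, hD⟩ := (isCompact_closedBall (0 : E n) B).exists_bound_of_continuousOn hG.continuousOn
  exact bdd_integrable (hG.measurable.comp hF).aestronglyMeasurable D fun x => hD _ (by simpa using hB x)

theorem jensen_sq {Ω : Type*} [MeasurableSpace Ω] (μ : Measure Ω) [IsProbabilityMeasure μ]
    (q : Seminorm ℝ (E n)) (hq : Continuous q) (F : Ω → E n) (hF : Measurable F) (B : ℝ)
    (hB : ∀ x, ‖F x‖ ≤ B) : q (∫ x, F x ∂μ) ^ 2 ≤ ∫ x, q (F x) ^ 2 ∂μ := by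
  have hc : ConvexOn ℝ Set.univ (fun x => q x ^ 2) := q.convexOn.pow (fun x _ => apply_nonneg q x) 2
  exact hc.map_integral_le (hq.pow 2).continuousOn isClosed_univ (by simp)
    (bdd_integrable hF.aestronglyMeasurable B hB)
    (vb_int_q μ (fun x => q x ^ 2) (hq.pow 2) F hF B hB)

/-- the L2 seminorm -/
def NN (q : Seminorm ℝ (E n)) (hq : Continuous q) : Seminorm ℝ (Vb n) :=
  Seminorm.of (fun f => √(∫ u, q (f.1 u) ^ 2 ∂(gam n)))
    (by
      rintro ⟨f, hf, B, hB⟩ ⟨g, hg, B', hB'⟩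
      have i1 := vb_int_q (gam n) (fun x => q x ^ 2) (hq.pow 2) f hf B hB
      have i2 := vb_int_q (gam n) (fun x => q x ^ 2) (hq.pow 2) g hg B' hB'
      have j1 := vb_int_q (gam n) q hq f hf B hB
      obtain ⟨D, hD⟩ := (isCompact_closedBall (0 : E n) B).exists_bound_of_continuousOn hq.continuousOn
      have i3 : Integrable (fun u => q (f u) * q (g u)) (gam n) :=
        (vb_int_q (gam n) q hq g hg B' hB').bdd_mul (c := D) (hq.measurable.comp hf).aestronglyMeasurable
          (ae_of_all _ fun x => hD _ (by simpa using hB x))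
      have i4 := vb_int_q (gam n) (fun x => q x ^ 2) (hq.pow 2) (f + g) (hf.add hg) (B + B')
        (fun u => (norm_add_le _ _).trans (add_le_add (hB u) (hB' u)))
      have hcs := cs_int (gam n) (fun u => q (f u)) (fun u => q (g u)) i1 i2 i3
      show √(∫ u, q (f u + g u) ^ 2 ∂(gam n)) ≤ √(∫ u, q (f u) ^ 2 ∂(gam n)) + √(∫ u, q (g u) ^ 2 ∂(gam n))
      apply Real.sqrt_le_iff.2
      refine ⟨by positivity, ?_⟩
      have h1 : ∫ u, q (f u + g u) ^ 2 ∂(gam n) ≤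
          ∫ u, (q (f u) ^ 2 + 2 * (q (f u) * q (g u))) + q (g u) ^ 2 ∂(gam n) := by
        apply integral_mono i4 ((i1.add (i3.const_mul 2)).add i2)
        intro u
        show q (f u + g u) ^ 2 ≤ (q (f u) ^ 2 + 2 * (q (f u) * q (g u))) + q (g u) ^ 2
        have := map_add_le_add q (f u) (g u)
        have h0 := apply_nonneg q (f u + g u)
        nlinarith
      have i13 : Integrable (fun u => q (f u) ^ 2 + 2 * (q (f u) * q (g u))) (gam n) :=
        i1.add (i3.const_mul 2)
      rw [integral_add i13 i2, integral_add i1 (i3.const_mul 2), integral_const_mul] at h1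
      have s1 := Real.sq_sqrt (integral_nonneg (μ := gam n) fun u => sq_nonneg (q (f u)))
      have s2 := Real.sq_sqrt (integral_nonneg (μ := gam n) fun u => sq_nonneg (q (g u)))
      nlinarith)
    (by
      intro a f
      show √(∫ u, q (a • f.1 u) ^ 2 ∂(gam n)) = ‖a‖ * √(∫ u, q (f.1 u) ^ 2 ∂(gam n))
      simp only [map_smul_eq_mul, mul_pow]
      rw [integral_const_mul, Real.sqrt_mul (by positivity), Real.sqrt_sq (norm_nonneg a)])

theorem NN_sq (q : Seminorm ℝ (E n)) (hq : Continuous q) (f : Vb n) :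
    NN q hq f ^ 2 = ∫ u, q (f.1 u) ^ 2 ∂(gam n) :=
  Real.sq_sqrt (integral_nonneg fun u => sq_nonneg (q (f.1 u)))

theorem ou_mem (s c : ℝ) (f : Vb n) :
    (fun u : E n => ∫ v, f.1 (s • u + c • v) ∂(gam n)) ∈ Vb n := by
  obtain ⟨f, hf, B, hB⟩ := f
  refine ⟨?_, B, fun u => ?_⟩
  · have h1 : StronglyMeasurable (fun p : E n × E n => f (s • p.1 + c • p.2)) :=
      (hf.comp (by fun_prop)).stronglyMeasurable
    exact h1.integral_prod_right'.measurable
  · have := norm_integral_le_of_norm_le_const (μ := gam n) (ae_of_all _ fun v => hB (s • u + c • v))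
    simpa using this

theorem ou_int (s c : ℝ) (f : Vb n) (u : E n) : Integrable (fun v => f.1 (s • u + c • v)) (gam n) := by
  obtain ⟨f, hf, B, hB⟩ := f
  exact bdd_integrable (hf.comp (by fun_prop)).aestronglyMeasurable B fun v => hB _

/-- Mehler operators -/
def ou (s c : ℝ) : Vb n →ₗ[ℝ] Vb n where
  toFun f := ⟨fun u => ∫ v, f.1 (s • u + c • v) ∂(gam n), ou_mem s c f⟩
  map_add' f g := by
    apply Subtype.ext; funext u
    exact integral_add (ou_int s c f u) (ou_int s c g u)
  map_smul' a f := by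
    apply Subtype.ext; funext u
    exact integral_smul a _

theorem ou_apply (s c : ℝ) (f : Vb n) (u : E n) : (ou s c f).1 u = ∫ v, f.1 (s • u + c • v) ∂(gam n) := rfl

theorem ou_comp (s c r d k : ℝ) (h : (r * c) ^ 2 + d ^ 2 = k ^ 2) (f : Vb n) :
    ou s c (ou r d f) = ou (s * r) k f := by
  apply Subtype.ext; funext u
  simp only [ou_apply]
  obtain ⟨f, hf, B, hB⟩ := f
  have hi : Integrable (fun p : E n × E n => f (r • (s • u + c • p.1) + d • p.2)) ((gam n).prod (gam n)) :=
    bdd_integrable (hf.comp (by fun_prop)).aestronglyMeasurable B fun p => hB _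
  rw [← integral_prod (f := fun p : E n × E n => f (r • (s • u + c • p.1) + d • p.2)) hi]
  have h1 := gam_comb (n := n) (r * c) d k h
  have hm : Measurable fun w : E n => f ((s * r) • u + w) := hf.comp (by fun_prop)
  have e1 := integral_map (μ := (gam n).prod (gam n)) (φ := fun p : E n × E n => (r * c) • p.1 + d • p.2)
    (by fun_prop) (f := fun w => f ((s * r) • u + w)) hm.aestronglyMeasurable
  have e2 := integral_map (μ := gam n) (φ := fun v : E n => k • v)
    (by fun_prop) (f := fun w => f ((s * r) • u + w)) hm.aestronglyMeasurable
  rw [h1, e2] at e1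
  rw [e1]
  congr 1; funext p
  congr 1
  rw [smul_add, smul_smul, smul_smul, mul_comm r s]; abel

/-- product integrability helper -/
theorem vb_prod (q : Seminorm ℝ (E n)) (hq : Continuous q) (F : E n × E n → E n) (hF : Measurable F)
    (B : ℝ) (hB : ∀ p, ‖F p‖ ≤ B) :
    ∫ u, q (∫ v, F (u, v) ∂(gam n)) ^ 2 ∂(gam n) ≤ ∫ p, q (F p) ^ 2 ∂((gam n).prod (gam n)) := by
  have hi := vb_int_q ((gam n).prod (gam n)) (fun x => q x ^ 2) (hq.pow 2) F hF B hB
  rw [integral_prod _ hi]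
  apply integral_mono
  · refine vb_int_q (gam n) (fun x => q x ^ 2) (hq.pow 2) _ ?_ B fun u => ?_
    · exact hF.stronglyMeasurable.integral_prod_right'.measurable
    · have := norm_integral_le_of_norm_le_const (μ := gam n) (ae_of_all _ fun v => hB (u, v))
      simpa using this
  · exact hi.integral_prod_left
  · intro u
    exact jensen_sq (gam n) q hq (fun v => F (u, v)) (hF.comp (by fun_prop)) B fun v => hB _

theorem ou_contr (q : Seminorm ℝ (E n)) (hq : Continuous q) (s c : ℝ) (h : s ^ 2 + c ^ 2 = 1) (f : Vb n) :
    NN q hq (ou s c f) ≤ NN q hq f := by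
  apply le_of_sq_le_sq _ (apply_nonneg _ _)
  rw [NN_sq, NN_sq]
  obtain ⟨f, hf, B, hB⟩ := f
  have h1 := vb_prod q hq (fun p => f (s • p.1 + c • p.2)) (hf.comp (by fun_prop)) B fun p => hB _
  refine h1.trans (le_of_eq ?_)
  exact gam_marg (F := fun u => q (f u) ^ 2) ((hq.pow 2).measurable.comp hf) s c h

/-- the quantitative dichotomy -/
theorem ou_dichotomy (q : Seminorm ℝ (E n)) (hq : Continuous q) (η κ : ℝ) (hη : 0 ≤ η) (hκ : κ = 1 / 18)
    (hconv : ∀ U W : E n, q ((2⁻¹ : ℝ) • (U + W)) ^ 2 + η / 4 * q (U - W) ^ 2 ≤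
      (1 + η * κ / 4) * ((q U ^ 2 + q W ^ 2) / 2))
    (s c : ℝ) (h : s ^ 2 + c ^ 2 = 1) (g : Vb n) :
    NN q hq (g - ou s c (ou s c g)) ≤ 1 / 3 * NN q hq g ∨ NN q hq (ou s c g) ≤ √(1 - η / 72) * NN q hq g := by
  have hcontr := ou_contr q hq s c h g
  have hg0 := apply_nonneg (NN q hq) g
  have hT0 := apply_nonneg (NN q hq) (ou s c g)
  have hD0 := apply_nonneg (NN q hq) (g - ou s c (ou s c g))
  have main : NN q hq (ou s c g) ^ 2 + η / 4 * NN q hq (g - ou s c (ou s c g)) ^ 2 ≤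
      (1 + η * κ / 4) * NN q hq g ^ 2 := by
    obtain ⟨hf, B, hB⟩ := g.2
    obtain ⟨hW, B', hB'⟩ := (ou s c g).2
    set U : E n × E n → E n := fun p => g.1 (s • p.1 + c • p.2) with hU
    set W : E n × E n → E n := fun p => (ou s c g).1 p.1 with hWd
    have mU : Measurable U := hf.comp (by fun_prop)
    have mW : Measurable W := hW.comp measurable_fst
    have bU : ∀ p, ‖U p‖ ≤ B := fun p => hB _
    have bW : ∀ p, ‖W p‖ ≤ B' := fun p => hB' _
    have mA : Measurable fun p => (2⁻¹ : ℝ) • (U p + W p) := by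
      have h1 : Measurable fun p => U p + W p := mU.add mW
      exact h1.const_smul (2⁻¹ : ℝ)
    have bA : ∀ p, ‖(2⁻¹ : ℝ) • (U p + W p)‖ ≤ ‖(2⁻¹ : ℝ)‖ * (B + B') := fun p => by
      rw [norm_smul]
      exact mul_le_mul_of_nonneg_left ((norm_add_le _ _).trans (add_le_add (bU p) (bW p))) (norm_nonneg _)
    have bS : ∀ p, ‖U p - W p‖ ≤ B + B' := fun p => (norm_sub_le _ _).trans (add_le_add (bU p) (bW p))
    have iA := vb_int_q ((gam n).prod (gam n)) (fun x => q x ^ 2) (hq.pow 2) _ mA _ bA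
    have iS : Integrable (fun x => q (U x - W x) ^ 2) ((gam n).prod (gam n)) := vb_int_q ((gam n).prod (gam n)) (fun x => q x ^ 2) (hq.pow 2) _ (mU.sub mW) _ bS
    have iU := vb_int_q ((gam n).prod (gam n)) (fun x => q x ^ 2) (hq.pow 2) _ mU _ bU
    have iW := vb_int_q ((gam n).prod (gam n)) (fun x => q x ^ 2) (hq.pow 2) _ mW _ bW
    have e1 : NN q hq (ou s c g) ^ 2 ≤ ∫ p, q ((2⁻¹ : ℝ) • (U p + W p)) ^ 2 ∂((gam n).prod (gam n)) := by
      have := vb_prod q hq _ mA _ bA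
      refine le_trans (le_of_eq ?_) this
      rw [NN_sq]
      congr 1; funext u
      have z : ∫ v, (2⁻¹ : ℝ) • (U (u, v) + W (u, v)) ∂(gam n) = (ou s c g).1 u := by
        rw [integral_smul]
        have z1 : ∫ v, (U (u, v) + W (u, v)) ∂(gam n) = (ou s c g).1 u + (ou s c g).1 u := by
          refine (integral_add (ou_int s c g u) (integrable_const ((ou s c g).1 u))).trans ?_
          rw [← ou_apply, integral_const, probReal_univ, one_smul]
        rw [z1, ← two_smul ℝ ((ou s c g).1 u), smul_smul]; norm_num
      rw [z]
    have e2 : NN q hq (g - ou s c (ou s c g)) ^ 2 ≤ ∫ p, q (U p - W p) ^ 2 ∂((gam n).prod (gam n)) := by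
      have sw := gam_swap (n := n) (F := fun x => q (g.1 x.1 - (ou s c g).1 x.2) ^ 2)
        ((hq.pow 2).measurable.comp ((hf.comp measurable_fst).sub (hW.comp measurable_snd))) s c h
      have h2 : ∫ p, q (U p - W p) ^ 2 ∂((gam n).prod (gam n)) = _ := sw
      rw [h2]
      have := vb_prod q hq (fun p : E n × E n => g.1 p.1 - (ou s c g).1 (s • p.1 + c • p.2))
        ((hf.comp measurable_fst).sub (hW.comp (by fun_prop))) (B + B')
        (fun p => (norm_sub_le _ _).trans (add_le_add (hB _) (hB' _)))
      refine le_trans (le_of_eq ?_) this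
      rw [NN_sq]
      congr 1; funext u
      have z : ∫ v, (g.1 u - (ou s c g).1 (s • u + c • v)) ∂(gam n) = (g - ou s c (ou s c g)).1 u := by
        refine (integral_sub (integrable_const (g.1 u)) (ou_int s c (ou s c g) u)).trans ?_
        rw [← ou_apply, integral_const, probReal_univ, one_smul]
        rfl
      exact congrArg (fun x => q x ^ 2) z.symm
    have e3 : ∫ p, q (U p) ^ 2 ∂((gam n).prod (gam n)) = NN q hq g ^ 2 := by
      rw [NN_sq]
      exact gam_marg (F := fun u => q (g.1 u) ^ 2) ((hq.pow 2).measurable.comp hf) s c h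
    have e4 : ∫ p, q (W p) ^ 2 ∂((gam n).prod (gam n)) = NN q hq (ou s c g) ^ 2 := by
      rw [NN_sq]
      have := integral_fun_fst (μ := gam n) (ν := gam n) (fun u => q ((ou s c g).1 u) ^ 2)
      simpa using this
    have e5 : ∫ p, (q ((2⁻¹ : ℝ) • (U p + W p)) ^ 2 + η / 4 * q (U p - W p) ^ 2) ∂((gam n).prod (gam n)) ≤
        ∫ p, (1 + η * κ / 4) * ((q (U p) ^ 2 + q (W p) ^ 2) / 2) ∂((gam n).prod (gam n)) :=
      integral_mono (iA.add (iS.const_mul _)) (((iU.add iW).div_const 2).const_mul _) fun p => hconv _ _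
    rw [integral_add iA (iS.const_mul _), integral_const_mul, integral_const_mul, integral_div,
      integral_add iU iW, e3, e4] at e5
    have e6 : NN q hq (ou s c g) ^ 2 ≤ NN q hq g ^ 2 := pow_le_pow_left₀ hT0 hcontr 2
    have hk : 0 ≤ η * κ := by rw [hκ]; positivity
    calc _ ≤ _ := add_le_add e1 (mul_le_mul_of_nonneg_left e2 (by positivity))
      _ ≤ _ := e5
      _ ≤ (1 + η * κ / 4) * ((NN q hq g ^ 2 + NN q hq g ^ 2) / 2) := by gcongr
      _ = _ := by ring
  by_cases hcase : NN q hq (g - ou s c (ou s c g)) ≤ 1 / 3 * NN q hq g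
  · exact Or.inl hcase
  right
  push Not at hcase
  have h9 : (1 / 3 * NN q hq g) ^ 2 ≤ NN q hq (g - ou s c (ou s c g)) ^ 2 :=
    pow_le_pow_left₀ (by positivity) hcase.le 2
  rw [← Real.sqrt_sq hg0, ← Real.sqrt_mul' _ (sq_nonneg _)]
  apply Real.le_sqrt_of_sq_le
  have h10 := mul_le_mul_of_nonneg_left h9 (by positivity : 0 ≤ η / 4)
  rw [hκ] at main
  linarith


/-! ### Pointwise uniform convexity -/

theorem uc_aux (q : Seminorm ℝ (E n)) (δ : ℝ) (hδ : 0 < δ) (hδ1 : δ ≤ 1)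
    (huc : ∀ x y, q x ≤ 1 → q y ≤ 1 → 1 / 36 ≤ q (x - y) → q ((2⁻¹ : ℝ) • (x + y)) ≤ 1 - δ)
    (U W : E n) (hUW : q W ≤ q U) :
    q ((2⁻¹ : ℝ) • (U + W)) ^ 2 + δ ^ 2 / 16 / 4 * q (U - W) ^ 2 ≤
      (1 + δ ^ 2 / 16 * (1 / 18) / 4) * ((q U ^ 2 + q W ^ 2) / 2) := by
  have hb := apply_nonneg q W
  have hD0 := apply_nonneg q (U - W)
  have hM0 := apply_nonneg q ((2⁻¹ : ℝ) • (U + W))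
  have hD : q (U - W) ≤ q U + q W := map_sub_le_add q U W
  have hM : q ((2⁻¹ : ℝ) • (U + W)) ≤ (q U + q W) / 2 := by
    rw [map_smul_eq_mul, Real.norm_eq_abs, abs_of_pos (by norm_num : (0:ℝ) < 2⁻¹)]
    have := map_add_le_add q U W
    linarith
  have hS : 0 < q U → 1 / 36 * q U ≤ q (U - W) → q ((2⁻¹ : ℝ) • (U + W)) ≤ q U * (1 - δ) := by
    intro ha h
    have hi : ‖(q U)⁻¹‖ = (q U)⁻¹ := by rw [Real.norm_eq_abs, abs_of_pos (inv_pos.2 ha)]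
    have := huc ((q U)⁻¹ • U) ((q U)⁻¹ • W)
      (by rw [map_smul_eq_mul, hi, inv_mul_cancel₀ ha.ne'])
      (by rw [map_smul_eq_mul, hi, inv_mul_le_iff₀ ha]; linarith)
      (by rw [← smul_sub, map_smul_eq_mul, hi, inv_mul_eq_div, le_div_iff₀ ha]; exact h)
    rw [← smul_add, smul_comm, map_smul_eq_mul, hi, inv_mul_le_iff₀ ha] at this
    exact this
  generalize q U = a at *
  generalize q W = b at *
  generalize q (U - W) = D at *
  generalize q ((2⁻¹ : ℝ) • (U + W)) = M at *
  have ha : 0 ≤ a := hb.trans hUW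
  have hD2 : D ^ 2 ≤ 4 * a ^ 2 := by nlinarith
  have hM2 : M ^ 2 ≤ ((a + b) / 2) ^ 2 := pow_le_pow_left₀ hM0 hM 2
  have hpos : 0 ≤ δ ^ 2 / 16 * (1 / 18) / 4 * ((a ^ 2 + b ^ 2) / 2) := by positivity
  have hδ2 : δ ^ 2 ≤ δ := by nlinarith
  have hη : δ ^ 2 / 16 / 4 * D ^ 2 ≤ δ ^ 2 / 16 * a ^ 2 := by
    have := mul_le_mul_of_nonneg_left hD2 (by positivity : 0 ≤ δ ^ 2 / 16 / 4)
    linarith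
  rcases le_total (δ * a / 2) (a - b) with h1 | h1
  · have h2 : (δ * a / 2) ^ 2 ≤ (a - b) ^ 2 := pow_le_pow_left₀ (by positivity) h1 2
    nlinarith
  · rcases le_total D (1 / 36 * a) with h2 | h2
    · have h3 : D ^ 2 ≤ (1 / 36 * a) ^ 2 := pow_le_pow_left₀ hD0 h2 2
      have h4 : D ^ 2 ≤ 1 / 18 * ((a ^ 2 + b ^ 2) / 2) := by nlinarith
      have h5 := mul_le_mul_of_nonneg_left h4 (by positivity : 0 ≤ δ ^ 2 / 16 / 4)
      nlinarith [sq_nonneg (a - b)]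
    · rcases ha.eq_or_lt with h0 | h0
      · have : b = 0 := by linarith
        subst this
        rw [← h0] at *
        nlinarith
      · have h3 := hS h0 h2
        have h4 : M ^ 2 ≤ (a * (1 - δ)) ^ 2 := pow_le_pow_left₀ hM0 h3 2
        have h5 : (a * (1 - δ)) ^ 2 ≤ a ^ 2 * (1 - δ) := by
          have : a ^ 2 * (1 - δ) ^ 2 ≤ a ^ 2 * (1 - δ) :=
            mul_le_mul_of_nonneg_left (by nlinarith) (sq_nonneg a)
          linarith [mul_pow a (1 - δ) 2]
        have hb2 : a * (1 - δ / 2) ≤ b := by linarith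
        have h6 : (a * (1 - δ / 2)) ^ 2 ≤ b ^ 2 :=
          pow_le_pow_left₀ (mul_nonneg ha (by linarith)) hb2 2
        have h7 : a ^ 2 * (1 - δ) ≤ (a * (1 - δ / 2)) ^ 2 := by
          have : a ^ 2 * (1 - δ) ≤ a ^ 2 * (1 - δ / 2) ^ 2 :=
            mul_le_mul_of_nonneg_left (by nlinarith) (sq_nonneg a)
          linarith [mul_pow a (1 - δ / 2) 2]
        have h8 : δ ^ 2 * a ^ 2 ≤ δ * a ^ 2 := mul_le_mul_of_nonneg_right hδ2 (sq_nonneg a)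
        have h9 : 0 ≤ δ * a ^ 2 := by positivity
        linarith

theorem uc_conv (q : Seminorm ℝ (E n)) (δ : ℝ) (hδ : 0 < δ) (hδ1 : δ ≤ 1)
    (huc : ∀ x y, q x ≤ 1 → q y ≤ 1 → 1 / 36 ≤ q (x - y) → q ((2⁻¹ : ℝ) • (x + y)) ≤ 1 - δ)
    (U W : E n) :
    q ((2⁻¹ : ℝ) • (U + W)) ^ 2 + δ ^ 2 / 16 / 4 * q (U - W) ^ 2 ≤
      (1 + δ ^ 2 / 16 * (1 / 18) / 4) * ((q U ^ 2 + q W ^ 2) / 2) := by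
  rcases le_total (q W) (q U) with h | h
  · exact uc_aux q δ hδ hδ1 huc U W h
  · have := uc_aux q δ hδ hδ1 huc W U h
    rw [map_sub_rev q U W, add_comm U W, add_comm (q U ^ 2)]
    exact this

/-- the uniform convexity parameter -/
def dl (p α : ℝ) : ℝ := min 1 (α * (1 / 36 : ℝ) ^ p)

theorem dl_pos (p α : ℝ) (hα : 0 < α) : 0 < dl p α :=
  lt_min one_pos (mul_pos hα (Real.rpow_pos_of_pos (by norm_num) p))

theorem body_uc {K : Set (E n)} {p α : ℝ} (hK : IsPConvexBody K p α) (q : Seminorm ℝ (E n))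
    (hq : ∀ x, q x = gauge K x) (x y : E n) (hx : q x ≤ 1) (hy : q y ≤ 1) (h : 1 / 36 ≤ q (x - y)) :
    q ((2⁻¹ : ℝ) • (x + y)) ≤ 1 - dl p α := by
  have h1 := hK.2 (1 / 36) (by norm_num) (by norm_num)
  have h2 : modConv K (1 / 36) ≤ 1 - q ((2⁻¹ : ℝ) • (x + y)) := by
    apply csInf_le
    · refine ⟨0, ?_⟩
      rintro d ⟨x, y, hx, hy, -, rfl⟩
      rw [← hq] at *
      rw [map_smul_eq_mul, Real.norm_eq_abs, abs_of_pos (by norm_num : (0:ℝ) < 2⁻¹)]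
      have := map_add_le_add q x y
      linarith
    · refine ⟨x, y, ?_, ?_, ?_, ?_⟩
      · rw [← hq]; exact hx
      · rw [← hq]; exact hy
      · rw [← hq]; exact h
      · rw [hq]
  have h3 : dl p α ≤ α * (1 / 36 : ℝ) ^ p := min_le_right _ _
  linarith


/-! ### The semigroup bound -/

/-- the cosine parameter -/
def oc (t : ℝ) : ℝ := √(1 - Real.exp (-t) ^ 2)

theorem oc_sq (t : ℝ) (ht : 0 ≤ t) : oc t ^ 2 = 1 - Real.exp (-t) ^ 2 := by
  apply Real.sq_sqrt
  have h1 : Real.exp (-t) ≤ 1 := Real.exp_le_one_iff.2 (by linarith)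
  have h0 := Real.exp_pos (-t)
  nlinarith

/-- the Ornstein-Uhlenbeck semigroup -/
def OU (t : ℝ) : Vb n →ₗ[ℝ] Vb n := ou (Real.exp (-t)) (oc t)

theorem OU_add (s t : ℝ) (hs : 0 ≤ s) (ht : 0 ≤ t) (f : Vb n) : OU (s + t) f = OU s (OU t f) := by
  unfold OU
  rw [ou_comp _ _ _ _ (oc (s + t))]
  · rw [← Real.exp_add, neg_add]
  · rw [mul_pow, oc_sq s hs, oc_sq t ht, oc_sq _ (add_nonneg hs ht), neg_add, Real.exp_add]
    ring

theorem OU_zero (f : Vb n) : OU 0 f = f := by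
  apply Subtype.ext; funext u
  unfold OU oc
  rw [ou_apply]
  simp

/-- parameter for the contraction -/
def th (p α : ℝ) : ℝ := √(1 - dl p α ^ 2 / 16 / 72)

theorem th_lt (p α : ℝ) (hα : 0 < α) : th p α < 1 := by
  unfold th
  have := dl_pos p α hα
  rw [Real.sqrt_lt' one_pos]
  have : 0 < dl p α ^ 2 / 16 / 72 := by positivity
  linarith

/-- the final number of steps -/
def ms (p α : ℝ) : ℕ := sInf {m : ℕ | 0 < m ∧ 2 * th p α ^ m ≤ 1 / 3}

theorem ms_spec (p α : ℝ) (hα : 0 < α) : 0 < ms p α ∧ 2 * th p α ^ (ms p α) ≤ 1 / 3 := by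
  have hne : {m : ℕ | 0 < m ∧ 2 * th p α ^ m ≤ 1 / 3}.Nonempty := by
    obtain ⟨m, hm⟩ := exists_pow_lt_of_lt_one (by norm_num : (0:ℝ) < 1 / 6) (th_lt p α hα)
    refine ⟨m, ?_, by linarith⟩
    rcases Nat.eq_zero_or_pos m with h | h
    · rw [h] at hm; norm_num at hm
    · exact h
  exact Nat.sInf_mem hne

/-- the bound for the first coefficient -/
def FF (p α : ℝ) : ℝ :=
  2 * Real.exp 1 * 1 * Real.exp (2 * π * Real.exp 1 / (2 / (ms p α : ℝ)))

theorem FF_pos (p α : ℝ) : 0 < FF p α := by unfold FF; positivity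

/-- pairing functional -/
def PhiY (Y : E n → E n) (hYm : Measurable Y) (B : ℝ) (hYB : ∀ u, ‖Y u‖ ≤ B) : Vb n →ₗ[ℝ] ℝ :=
  have hIntg : ∀ f : Vb n, Integrable (fun u => ⟪f.1 u, Y u⟫) (gam n) := by
    rintro ⟨f, hf, B', hB'⟩
    refine bdd_integrable (hf.inner hYm).aestronglyMeasurable (B' * B) fun u => ?_
    exact (norm_inner_le_norm _ _).trans
      (mul_le_mul (hB' u) (hYB u) (norm_nonneg _) ((norm_nonneg _).trans (hB' u)))
  { toFun := fun f => ∫ u, ⟪f.1 u, Y u⟫ ∂(gam n)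
    map_add' := fun f g => by
      rw [← integral_add (hIntg f) (hIntg g)]
      congr 1; funext u
      exact inner_add_left _ _ _
    map_smul' := fun a f => by
      rw [RingHom.id_apply, smul_eq_mul, ← integral_const_mul]
      congr 1; funext u
      exact real_inner_smul_left _ _ _ }

theorem PhiY_apply (Y : E n → E n) (hYm : Measurable Y) (B : ℝ) (hYB : ∀ u, ‖Y u‖ ≤ B) (f : Vb n) :
    PhiY Y hYm B hYB f = ∫ u, ⟪f.1 u, Y u⟫ ∂(gam n) := rfl

theorem PhiY_le (q : Seminorm ℝ (E n)) (hq : Continuous q) (Y : E n → E n) (hYm : Measurable Y) (B : ℝ)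
    (hYB : ∀ u, ‖Y u‖ ≤ B) (hYq : ∀ u z, |⟪Y u, z⟫| ≤ q z) (f : Vb n) :
    |PhiY Y hYm B hYB f| ≤ 1 * NN q hq f := by
  rw [one_mul, PhiY_apply]
  obtain ⟨hf, B', hB'⟩ := f.2
  have i1 := vb_int_q (gam n) q hq f.1 hf B' hB'
  have i2 := vb_int_q (gam n) (fun x => q x ^ 2) (hq.pow 2) f.1 hf B' hB'
  have h1 : |∫ u, ⟪f.1 u, Y u⟫ ∂(gam n)| ≤ ∫ u, q (f.1 u) ∂(gam n) := by
    rw [← Real.norm_eq_abs]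
    refine norm_integral_le_of_norm_le i1 (ae_of_all _ fun u => ?_)
    rw [Real.norm_eq_abs, real_inner_comm]
    exact hYq u _
  have h2 := cs_int (gam n) (fun u => q (f.1 u)) (fun _ => 1) i2 (integrable_const _) (by simpa using i1)
  simp only [mul_one, one_pow, integral_const, probReal_univ, smul_eq_mul, Real.sqrt_one] at h2
  exact h1.trans h2

theorem PhiY_OU (Y : E n → E n) (hYm : Measurable Y) (B : ℝ) (hYB : ∀ u, ‖Y u‖ ≤ B) (s c : ℝ) (f : Vb n) :
    PhiY Y hYm B hYB (ou s c f) =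
      ∫ p, ⟪f.1 (s • p.1 + c • p.2), Y p.1⟫ ∂((gam n).prod (gam n)) := by
  obtain ⟨hf, B', hB'⟩ := f.2
  rw [PhiY_apply, integral_prod]
  · congr 1; funext u
    rw [ou_apply, real_inner_comm, ← integral_inner (ou_int s c f u)]
    congr 1; funext v
    exact real_inner_comm _ _
  · have hm : Measurable fun p : E n × E n => f.1 (s • p.1 + c • p.2) := hf.comp (by fun_prop)
    refine bdd_integrable (hm.inner (hYm.comp measurable_fst)).aestronglyMeasurable (B' * B) fun u => ?_
    exact (norm_inner_le_norm _ _).trans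
      (mul_le_mul (hB' _) (hYB _) (norm_nonneg _) ((norm_nonneg _).trans (hB' u.1)))

theorem A1_bound_pconvex {K : Set (E n)} {p α : ℝ} (hα : 0 < α) (hK : IsPConvexBody K p α)
    (q : Seminorm ℝ (E n)) (hqc : Continuous q) (hq : ∀ x, q x = gauge K x)
    (X Y : E n → E n) (hXm : Measurable X) (hYm : Measurable Y) (B : ℝ)
    (hXB : ∀ u, ‖X u‖ ≤ B) (hYB : ∀ u, ‖Y u‖ ≤ B)
    (hXq : ∀ u, q (X u) ≤ 1) (hYq : ∀ u z, |⟪Y u, z⟫| ≤ q z)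
    (A : ℕ → ℂ) (hA : Summable fun k => ‖A k‖)
    (hexp : ∀ s c : ℝ, s ^ 2 + c ^ 2 = 1 → |s| < 1 →
      ((∫ p, ⟪X (s • p.1 + c • p.2), Y p.1⟫ ∂((gam n).prod (gam n)) : ℝ) : ℂ) = ∑' k, A k * (s : ℂ) ^ k) :
    ‖A 1‖ ≤ FF p α := by
  have hd := dl_pos p α hα
  obtain ⟨hm0, hm⟩ := ms_spec p α hα
  set m := ms p α with hmdef
  have hmr : (0:ℝ) < m := by exact_mod_cast hm0
  have hm1 : (1:ℝ) ≤ m := by exact_mod_cast hm0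
  set x₀ : ℝ := 2 / m with hx₀
  have hx0 : 0 < x₀ := by positivity
  have hx2 : x₀ ≤ 2 := by rw [hx₀, div_le_iff₀ hmr]; linarith
  have hc : ∀ t, 0 ≤ t → ∀ f : Vb n, NN q hqc (OU t f) ≤ NN q hqc f := fun t ht f =>
    ou_contr q hqc _ _ (by rw [oc_sq t ht]; ring) f
  have hor : ∀ h, 0 ≤ h → ∀ g : Vb n, NN q hqc (g - OU (2 * h) g) ≤ 1 / 3 * NN q hqc g ∨
      NN q hqc (OU h g) ≤ th p α * NN q hqc g := by
    intro h hh g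
    rw [two_mul, OU_add h h hh hh]
    exact ou_dichotomy q hqc (dl p α ^ 2 / 16) (1 / 18) (by positivity) rfl
      (uc_conv q (dl p α) hd (min_le_left _ _) (body_uc hK q hq)) _ _ (by rw [oc_sq h hh]; ring) g
  have h0 : ∀ t, 0 ≤ t → ∀ f : Vb n, NN q hqc (OU t f - OU (t + x₀ * t) f) ≤ 1 / 3 * NN q hqc f := by
    intro t ht f
    have := semigroup_start (NN q hqc) OU OU_add OU_zero hc (th p α) (Real.sqrt_nonneg _) m hm hor
      (t / m) (by positivity) f
    have e1 : (m : ℝ) * (t / m) = t := by field_simp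
    have e2 : 2 * (t / m) = x₀ * t := by rw [hx₀]; ring
    rw [e1, e2] at this
    exact this
  set f : Vb n := ⟨X, hXm, B, hXB⟩ with hf
  have hNf : NN q hqc f ≤ 1 := by
    apply Real.sqrt_le_one.2
    have i2 := vb_int_q (gam n) (fun x => q x ^ 2) (hqc.pow 2) X hXm B hXB
    have := integral_mono i2 (integrable_const (1:ℝ)) (fun u => by
      show q (X u) ^ 2 ≤ 1
      exact pow_le_one₀ (apply_nonneg q _) (hXq u))
    simpa using this
  have hΦ : ∀ t, 0 < t → ((PhiY Y hYm B hYB (OU t f) : ℝ) : ℂ) = ∑' k, A k * Real.exp (-t * k) := by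
    intro t ht
    unfold OU
    rw [PhiY_OU]
    have he : Real.exp (-t) < 1 := Real.exp_lt_one_iff.2 (by linarith)
    rw [hexp _ _ (by rw [oc_sq t ht.le]; ring) (by rw [abs_of_pos (Real.exp_pos _)]; exact he)]
    congr 1; funext k
    rw [mul_comm (-t) (k : ℝ), Real.exp_nat_mul]
    push_cast
    rfl
  have key := fun a ha j => deriv_bound (NN q hqc) OU OU_add hc x₀ hx0 h0 (PhiY Y hYm B hYB) 1 zero_le_one
    (PhiY_le q hqc Y hYm B hYB hYq) f A hA hΦ a ha j
  refine A1_le_of_deriv_bounds A hA 1 x₀ zero_le_one hx0 hx2 _ rfl fun j => ?_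
  have ha : 0 < 2 * π * Real.exp 1 / x₀ := by positivity
  refine (key _ ha j).trans ?_
  have : 0 ≤ (((j:ℝ) + 1) / (x₀ * (2 * π * Real.exp 1 / x₀))) ^ j := by positivity
  apply mul_le_mul_of_nonneg_right _ this
  linarith

theorem A1_bound_log (hn : 0 < n) (q : Seminorm ℝ (E n))
    (X Y : E n → E n)
    (hXq : ∀ u, q (X u) ≤ 1) (hYq : ∀ u z, |⟪Y u, z⟫| ≤ q z)
    (A : ℕ → ℂ) (hA : Summable fun k => ‖A k‖) (hAn : ∑' k, ‖A k‖ ≤ n)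
    (hexp : ∀ s c : ℝ, s ^ 2 + c ^ 2 = 1 → |s| < 1 →
      ((∫ p, ⟪X (s • p.1 + c • p.2), Y p.1⟫ ∂((gam n).prod (gam n)) : ℝ) : ℂ) = ∑' k, A k * (s : ℂ) ^ k) :
    ‖A 1‖ ≤ 2 * Real.exp 1 * (1 + 1 / Real.log 2) * Real.log (1 + n) := by
  have hn1 : (1:ℝ) ≤ n := by exact_mod_cast hn
  have h1 := A1_le_log A hA (1 + n) (by linarith) (by linarith) (by
    intro s hs
    have hs2 : s ^ 2 ≤ 1 := by
      rw [← sq_abs]; nlinarith [abs_nonneg s]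
    rw [← hexp s (√(1 - s ^ 2)) (by rw [Real.sq_sqrt (by linarith)]; ring) (by linarith),
      Complex.norm_real]
    have := norm_integral_le_of_norm_le_const (μ := (gam n).prod (gam n)) (C := 1)
      (f := fun p : E n × E n => ⟪X (s • p.1 + √(1 - s ^ 2) • p.2), Y p.1⟫)
      (ae_of_all _ fun p => by
        rw [Real.norm_eq_abs, real_inner_comm]
        exact (hYq _ _).trans (hXq _))
    simpa using this)
  refine h1.trans ?_
  have hl2 : 0 < Real.log 2 := Real.log_pos (by norm_num)
  have h2 : Real.log 2 ≤ Real.log (1 + n) := Real.log_le_log (by norm_num) (by linarith)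
  have h3 : 1 ≤ 1 / Real.log 2 * Real.log (1 + n) := by
    rw [one_div, inv_mul_eq_div, le_div_iff₀ hl2]; linarith
  rw [mul_assoc (2 * Real.exp 1) (1 + 1 / Real.log 2)]
  apply mul_le_mul_of_nonneg_left _ (by positivity)
  linarith


/-! ### Assembling -/

theorem grad_bdd (q : Seminorm ℝ (E n)) (C : ℝ) (hC : ∀ x, q x ≤ C * ‖x‖) (Y : E n → E n)
    (hY : ∀ u z, ⟪Y u, z⟫ ≤ q z) (u : E n) : ‖Y u‖ ≤ |C| := by
  have h1 := (hY u (Y u)).trans (hC _)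
  rw [real_inner_self_eq_norm_sq] at h1
  rcases (norm_nonneg (Y u)).eq_or_lt with h | h
  · rw [← h]; exact abs_nonneg _
  · refine le_trans ?_ (le_abs_self C)
    nlinarith

theorem gauge_int_lower {K : Set (E n)} (hn : 0 < n) (hK : IsConvexBody K) (hvol : volume K = 1)
    (q : Seminorm ℝ (E n)) (hq : ∀ x, q x = gauge K x) (C : ℝ) (hC : ∀ x, q x ≤ C * ‖x‖) :
    1 / 2 ≤ ∫ u, q u ∂(gam n) := by
  have hqc := (sem_lip q C hC).continuous
  have hKm : MeasurableSet K := hK.1.isClosed.measurableSet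
  have h1 := gam_small hn K hKm hvol
  have hIntg : Integrable (fun u => q u) (gam n) :=
    (gam_integrable_norm.const_mul C).mono hqc.aestronglyMeasurable (ae_of_all _ fun x => by
      rw [Real.norm_eq_abs, abs_of_nonneg (apply_nonneg q x), Real.norm_eq_abs]
      exact (hC x).trans (le_abs_self _))
  have h2 : ∫ u, Kᶜ.indicator (fun _ => (1:ℝ)) u ∂(gam n) ≤ ∫ u, q u ∂(gam n) := by
    apply integral_mono _ hIntg
    · intro u
      by_cases hu : u ∈ K
      · simpa [hu] using apply_nonneg q u
      · have : ¬ gauge K u ≤ 1 := fun h => hu ((body_gauge_le_one hK u).1 h)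
        rw [← hq] at this
        simpa [hu] using (not_le.1 this).le
    · exact (integrable_const (1:ℝ)).indicator hKm.compl
  rw [integral_indicator_const _ hKm.compl, smul_eq_mul, mul_one, probReal_compl_eq_one_sub hKm] at h2
  linarith

theorem Mstar_bound {K : Set (E n)} {p α : ℝ} (hn : 0 < n) (hα : 0 < α) (hK : IsPConvexBody K p α)
    (hvol : volume K = 1) (hmin : IsMinMeanWidth K)
    (hp : IsProbabilityMeasure (sphMeasure n))
    (hinv : ∀ e : E n ≃ₗᵢ[ℝ] E n, (sphMeasure n).map e = sphMeasure n)
    (hs : ∀ᵐ θ ∂(sphMeasure n), ‖θ‖ = 1) :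
    Mstar K ≤ √n * (2 / c0 * min (FF p α) (2 * Real.exp 1 * (1 + 1 / Real.log 2) * Real.log (1 + n))) := by
  have hB := hK.1
  obtain ⟨h, hh, C₁, hC₁⟩ := body_dual hB
  obtain ⟨q, hq, C₂, hC₂⟩ := body_gauge hB
  have hqc : Continuous q := (sem_lip q C₂ hC₂).continuous
  have hhc : Continuous h := (sem_lip h C₁ hC₁).continuous
  obtain ⟨X, hXm, hXle, hXd⟩ := grad_exists h C₁ hC₁
  obtain ⟨Y, hYm, hYle, hYd⟩ := grad_exists q C₂ hC₂
  set B := max |C₁| |C₂| with hBdef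
  have hXB : ∀ u, ‖X u‖ ≤ B := fun u => (grad_bdd h C₁ hC₁ X hXle u).trans (le_max_left _ _)
  have hYB : ∀ u, ‖Y u‖ ≤ B := fun u => (grad_bdd q C₂ hC₂ Y hYle u).trans (le_max_right _ _)
  have hXK : ∀ u, X u ∈ K := fun u => body_bipolar hB _ fun z => by rw [← hh]; exact hXle u z
  have hXq : ∀ u, q (X u) ≤ 1 := fun u => by rw [hq]; exact (body_gauge_le_one hB _).2 (hXK u)
  have hYq : ∀ u z, |⟪Y u, z⟫| ≤ q z := fun u z => by
    refine abs_le.2 ⟨?_, hYle u z⟩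
    have := hYle u (-z)
    rw [inner_neg_right, map_neg_eq_map] at this
    linarith
  have hYK : ∀ u, ∀ z ∈ K, |⟪Y u, z⟫| ≤ 1 := fun u z hz => (hYq u z).trans (by
    rw [hq]; exact (body_gauge_le_one hB _).2 hz)
  have hminG : ∀ T : E n →ₗ[ℝ] E n, |LinearMap.det T| = 1 →
      ∫ u, h u ∂(gam n) ≤ ∫ u, h (T u) ∂(gam n) := by
    intro T hT
    have := body_hmin hB hp hinv hs hmin T hT
    simpa only [hh] using this
  have hA1 := A1_identity hn h q C₁ hC₁ X Y hXm hYm B hXB hYB hXd hYd hminG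
  obtain ⟨A, hA, hAn, hA1', hexp⟩ := psi_expansion hB X Y hXm hYm B hXB hYB hXK hYK
  have b1 := A1_bound_pconvex hα hK q hqc hq X Y hXm hYm B hXB hYB hXq hYq A hA hexp
  have b2 := A1_bound_log hn q X Y hXq hYq A hA hAn hexp
  have b3 := le_min b1 b2
  set R := min (FF p α) (2 * Real.exp 1 * (1 + 1 / Real.log 2) * Real.log (1 + n)) with hR
  rw [hA1', Complex.norm_real, hA1] at b3
  have b4 := (le_abs_self _).trans b3
  have hg := gauge_int_lower hn hB hvol q hq C₂ hC₂
  have hpol := polar_int (sphMeasure n) hinv hs h hhc.measurable (fun r hr x => by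
    rw [map_smul_eq_mul, Real.norm_eq_abs, abs_of_nonneg hr])
  have hM : Mstar K = ∫ θ, h θ ∂(sphMeasure n) := by
    unfold Mstar; simp only [hh]
  rw [← hM] at hpol
  have hM0 : 0 ≤ Mstar K := by rw [hM]; exact integral_nonneg fun x => apply_nonneg h x
  have hh0 : 0 ≤ ∫ u, h u ∂(gam n) := integral_nonneg fun x => apply_nonneg h x
  have hnr : (0:ℝ) < n := by exact_mod_cast hn
  have hsn : 0 < √(n:ℝ) := Real.sqrt_pos.2 hnr
  have hc0 := c0_pos
  have hlow := gam_norm_lower hn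
  have s1 : 1 / 2 / (n:ℝ) * ∫ u, h u ∂(gam n) ≤ R :=
    le_trans (mul_le_mul_of_nonneg_right (by gcongr) hh0) b4
  have s2 : ∫ u, h u ∂(gam n) ≤ 2 * n * R := by
    have := mul_le_mul_of_nonneg_left s1 (by positivity : (0:ℝ) ≤ 2 * n)
    have e : 2 * (n:ℝ) * (1 / 2 / (n:ℝ) * ∫ u, h u ∂(gam n)) = ∫ u, h u ∂(gam n) := by field_simp
    rw [e] at this
    exact this
  have s3 : c0 * √n * Mstar K ≤ 2 * n * R := by
    refine le_trans ?_ s2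
    rw [hpol]
    exact mul_le_mul_of_nonneg_right hlow hM0
  have hsq : √(n:ℝ) * √n = n := Real.mul_self_sqrt hnr.le
  have s4 : (c0 * √n) * Mstar K ≤ (c0 * √n) * (√n * (2 / c0 * R)) := by
    refine s3.trans (le_of_eq ?_)
    have : (c0 * √n) * (√n * (2 / c0 * R)) = (√n * √n) * (2 * R) * (c0 / c0) := by ring
    rw [this, hsq, div_self hc0.ne']; ring
  exact le_of_mul_le_mul_left s4 (by positivity)


/-- mean width in minimal mean-width position. -/
theorem p_convex_min_mean_width :
    ∃ C > (0 : ℝ), ∃ f : ℝ → ℝ → ℝ,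
      (∀ p α : ℝ, 0 < α → 0 < f p α) ∧
      ∀ (n : ℕ) (K : Set (E n)) (p α : ℝ), 0 < α →
        IsPConvexBody K p α → volume K = 1 → IsMinMeanWidth K →
        Mstar K ≤ Real.sqrt n * min (f p α) (C * Real.log (1 + n)) := by
  have hc := c0_pos
  have hl2 : 0 < Real.log 2 := Real.log_pos (by norm_num)
  refine ⟨2 / c0 * (2 * Real.exp 1 * (1 + 1 / Real.log 2)), by positivity,
    fun p α => 2 / c0 * FF p α, fun p α _ => mul_pos (by positivity) (FF_pos p α), ?_⟩
  intro n K p α hα hK hvol hmin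
  have hRHS : 0 ≤ min (2 / c0 * FF p α)
      (2 / c0 * (2 * Real.exp 1 * (1 + 1 / Real.log 2)) * Real.log (1 + n)) := by
    have h1 : 0 ≤ Real.log (1 + (n:ℝ)) := Real.log_nonneg (by linarith [n.cast_nonneg (α := ℝ)])
    have h2 := FF_pos p α
    exact le_min (by positivity) (by positivity)
  have hzero : sphMeasure n = 0 → Mstar K ≤ Real.sqrt n * min (2 / c0 * FF p α)
      (2 / c0 * (2 * Real.exp 1 * (1 + 1 / Real.log 2)) * Real.log (1 + n)) := by
    intro h
    have : Mstar K = 0 := by unfold Mstar; rw [h, integral_zero_measure]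
    rw [this]
    exact mul_nonneg (Real.sqrt_nonneg _) hRHS
  rcases sph_cases n with h | ⟨hp, hinv, hs⟩
  · exact hzero h
  rcases Nat.eq_zero_or_pos n with hn | hn
  · exfalso
    subst hn
    obtain ⟨θ, hθ⟩ := hs.exists
    rw [Subsingleton.elim θ 0, norm_zero] at hθ
    exact zero_ne_one hθ
  · have := Mstar_bound hn hα hK hvol hmin hp hinv hs
    rw [mul_assoc (2 / c0), ← mul_min_of_nonneg _ _ (by positivity : 0 ≤ 2 / c0)]
    exact this


end GM
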